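/- Let Λ and Λ′ be two self-dual o_D-lattice functions of V with respect to h. Then the following are equivalent: (1) for every real number t, the κ_D-vector spaces Λ(t)/Λ(t+) and Λ′(t)/Λ′(t+) have the same dimension; (2) there exists g ∈ U(h) such that g(Λ(t)) = Λ′(t) for all t ∈ ℝ. -/

import Mathlib

noncomputable section

/-- Axioms expressing that `ν : K → EReal` is the additive valuation of a
non-Archimedean local (skew) field structure on `K`, normalized relatively to a base
field with valuation group `ℤ`, so that the value group of `K` is `(1/e)ℤ`; `K` is
complete and its residue field has exactly `q` elements (encoded by a complete finite
set of residue representatives). -/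
structure IsLocalValuation (K : Type*) [DivisionRing K] (ν : K → EReal) (e q : ℕ) : Prop where
  e_pos : 0 < e
  one_lt_q : 1 < q
  eq_top_iff : ∀ x : K, ν x = ⊤ ↔ x = 0
  map_mul : ∀ x y : K, ν (x * y) = ν x + ν y
  min_le_add : ∀ x y : K, min (ν x) (ν y) ≤ ν (x + y)
  values : ∀ x : K, x ≠ 0 → ∃ m : ℤ, ν x = ((m / e : ℝ) : EReal)
  exists_uniformizer : ∃ π : K, ν π = (((e : ℝ)⁻¹ : ℝ) : EReal)
  complete : ∀ x : ℕ → K,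
      (∀ M : ℝ, ∃ N : ℕ, ∀ m ≥ N, ∀ n ≥ N, (M : EReal) ≤ ν (x m - x n)) →
      ∃ l : K, ∀ M : ℝ, ∃ N : ℕ, ∀ n ≥ N, (M : EReal) ≤ ν (x n - l)
  residue : ∃ s : Finset K, s.card = q ∧ (∀ y ∈ s, 0 ≤ ν y) ∧
      ∀ x : K, 0 ≤ ν x → ∃! y, y ∈ s ∧ 0 < ν (x - y)

/-- `M` is an `o_D`-lattice in the right `D`-vector space `V`: a finitely generated
`o_D`-submodule (where `o_D = {y | 0 ≤ νD y}`) containing a `D`-basis of `V`. -/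
def IsODLattice {D V : Type*} [DivisionRing D] [AddCommGroup V] [Module Dᵐᵒᵖ V]
    (νD : D → EReal) (M : AddSubgroup V) : Prop :=
  (∀ v ∈ M, ∀ y : D, 0 ≤ νD y → MulOpposite.op y • v ∈ M) ∧
  (∃ s : Finset V, ↑s ⊆ (M : Set V) ∧ ∀ v ∈ M,
    v ∈ AddSubgroup.closure
      {w : V | ∃ u ∈ s, ∃ y : D, 0 ≤ νD y ∧ w = MulOpposite.op y • u}) ∧
  Submodule.span Dᵐᵒᵖ (M : Set V) = ⊤

/-- `Λ` is an `o_D`-lattice function on the right `D`-vector space `V`, where `D` has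
index `d` (so that prime elements of `D` have normalized valuation `1/d`):
a decreasing, left-continuous family of `o_D`-lattices with `Λ(t)·π_D = Λ(t + 1/d)`
for every prime element `π_D` of `D`. -/
def IsLatticeFunction {D V : Type*} [DivisionRing D] [AddCommGroup V] [Module Dᵐᵒᵖ V]
    (νD : D → EReal) (d : ℕ) (Λ : ℝ → AddSubgroup V) : Prop :=
  (∀ t : ℝ, IsODLattice νD (Λ t)) ∧
  (∀ s t : ℝ, s ≤ t → Λ t ≤ Λ s) ∧
  (∀ (t : ℝ) (v : V), v ∈ Λ t ↔ ∀ r : ℝ, r < t → v ∈ Λ r) ∧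
  (∀ π : D, νD π = (((d : ℝ)⁻¹ : ℝ) : EReal) →
    ∀ (t : ℝ) (w : V), w ∈ Λ (t + (d : ℝ)⁻¹) ↔ ∃ v ∈ Λ t, w = MulOpposite.op π • v)

namespace SelfDualLattice

section

/-- Two families with values in a type with involution whose fibre counts agree after
symmetrization differ by a permutation and sign changes. -/
theorem exists_perm_eq_or_eq_neg {ι X : Type*} [Fintype ι] [DecidableEq X] [InvolutiveNeg X]
    (f f' : ι → X)
    (H : ∀ x, (Finset.univ.filter fun i => f i = x).card
        + (Finset.univ.filter fun i => -f i = x).card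
      = (Finset.univ.filter fun i => f' i = x).card
        + (Finset.univ.filter fun i => -f' i = x).card) :
    ∃ σ : Equiv.Perm ι, ∀ i, f' (σ i) = f i ∨ f' (σ i) = -f i := by
  classical
  let S : Setoid X :=
    { r := fun x y => x = y ∨ x = -y
      iseqv := by
        refine ⟨fun x => Or.inl rfl, ?_, ?_⟩
        · rintro x y (rfl | rfl) <;> simp
        · rintro x y z (rfl | rfl) (rfl | rfl) <;> simp }
  have key : ∀ (g : ι → X) (x : X),
      (if x = -x then 2 else 1) * (Finset.univ.filter fun i => g i = x ∨ g i = -x).card =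
        (Finset.univ.filter fun i => g i = x).card
          + (Finset.univ.filter fun i => -g i = x).card := by
    intro g x
    have e : (Finset.univ.filter fun i => -g i = x) = Finset.univ.filter fun i => g i = -x := by
      ext i; simp [neg_eq_iff_eq_neg]
    rw [e]
    split_ifs with hx
    · rw [← hx]; simp [two_mul]
    · rw [one_mul, Finset.filter_or, Finset.card_union_of_disjoint]
      rw [Finset.disjoint_filter]
      rintro i - h1 h2
      exact hx (h1.symm.trans h2)
  have card_eq : ∀ x, (Finset.univ.filter fun i => f i = x ∨ f i = -x).card
      = (Finset.univ.filter fun i => f' i = x ∨ f' i = -x).card := by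
    intro x
    have h1 := (key f x).trans ((H x).trans (key f' x).symm)
    refine Nat.eq_of_mul_eq_mul_left ?_ h1
    split_ifs <;> norm_num
  have hfib : ∀ c : Quotient S,
      Nonempty ({i // (⟦f i⟧ : Quotient S) = c} ≃ {i // (⟦f' i⟧ : Quotient S) = c}) := by
    intro c
    induction c using Quotient.inductionOn with
    | h x =>
      rw [← Fintype.card_eq, Fintype.card_subtype, Fintype.card_subtype]
      have hS : ∀ a b, S a b ↔ a = b ∨ a = -b := fun _ _ => Iff.rfl
      simp only [Quotient.eq, hS]
      exact card_eq x
  let e := fun c => (hfib c).some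
  exact ⟨Equiv.ofFiberEquiv e, fun i => Quotient.eq.1 (Equiv.ofFiberEquiv_map e i)⟩

/-- Banach's fixed point theorem on a closed ball around zero. -/
theorem exists_fixedPoint_of_lipschitz {D : Type*} [NormedAddCommGroup D] [CompleteSpace D]
    (T : D → D) (R K : ℝ) (hR : 0 ≤ R) (hK0 : 0 ≤ K) (hK : K < 1)
    (hT : ∀ x, ‖x‖ ≤ R → ‖T x‖ ≤ R)
    (hL : ∀ x y, ‖x‖ ≤ R → ‖y‖ ≤ R → ‖T x - T y‖ ≤ K * ‖x - y‖) :
    ∃ x, ‖x‖ ≤ R ∧ T x = x := by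
  have hs : IsComplete (Metric.closedBall (0 : D) R) := Metric.isClosed_closedBall.isComplete
  have hm : Set.MapsTo T (Metric.closedBall (0 : D) R) (Metric.closedBall (0 : D) R) := by
    intro x hx
    simpa using hT x (by simpa using hx)
  have hc : ContractingWith (⟨K, hK0⟩ : NNReal) (hm.restrict T _ _) := by
    refine ⟨by exact_mod_cast hK, LipschitzWith.of_dist_le_mul ?_⟩
    rintro ⟨x, hx⟩ ⟨y, hy⟩
    rw [Subtype.dist_eq, Subtype.dist_eq, dist_eq_norm, dist_eq_norm]
    exact hL x y (by simpa using hx) (by simpa using hy)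
  obtain ⟨x, hx, hfx, -⟩ := ContractingWith.exists_fixedPoint' hs hm hc
    (x := 0) (by simpa using hR) (edist_ne_top _ _)
  exact ⟨x, by simpa using hx, hfx⟩

/-- A bounded window meets finitely many geometric progressions in a finite set. -/
theorem finite_window {θ : ℝ} (h0 : 0 < θ) (h1 : θ < 1) {G : Set ℝ} (hG : G.Finite)
    (hpos : ∀ g ∈ G, 0 < g) {a b : ℝ} (ha : 0 < a) :
    {x : ℝ | a ≤ x ∧ x ≤ b ∧ ∃ g ∈ G, ∃ m : ℤ, x = g * θ ^ m}.Finite := by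
  have hθ : Real.log θ < 0 := Real.log_neg h0 h1
  have : {x : ℝ | a ≤ x ∧ x ≤ b ∧ ∃ g ∈ G, ∃ m : ℤ, x = g * θ ^ m} ⊆
      ⋃ g ∈ G, (fun m : ℤ => g * θ ^ m) '' Set.Icc
        ⌊(Real.log b - Real.log g) / Real.log θ⌋ ⌈(Real.log a - Real.log g) / Real.log θ⌉ := by
    rintro x ⟨hax, hxb, g, hg, m, rfl⟩
    refine Set.mem_biUnion hg ⟨m, ⟨?_, ?_⟩, rfl⟩
    · rw [← Int.cast_le (R := ℝ)]
      refine (Int.floor_le _).trans ?_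
      rw [div_le_iff_of_neg hθ]
      have := Real.log_le_log (ha.trans_le hax) hxb
      rw [Real.log_mul (hpos g hg).ne' (zpow_pos h0 m).ne', Real.log_zpow] at this
      linarith
    · rw [← Int.cast_le (R := ℝ)]
      refine le_trans ?_ (Int.le_ceil _)
      rw [le_div_iff_of_neg hθ]
      have := Real.log_le_log ha hax
      rw [Real.log_mul (hpos g hg).ne' (zpow_pos h0 m).ne', Real.log_zpow] at this
      linarith
  refine Set.Finite.subset ?_ this
  exact hG.biUnion fun g _ => (Set.finite_Icc _ _).image _

end

section

/-- A division ring norm is discrete with value group `θ ^ ℤ`. -/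
structure IsDiscreteNorm (D : Type*) [NormedDivisionRing D] (θ : ℝ) : Prop where
  pos : 0 < θ
  lt_one : θ < 1
  exists_zpow : ∀ x : D, x ≠ 0 → ∃ m : ℤ, ‖x‖ = θ ^ m
  exists_uniformizer : ∃ π : D, ‖π‖ = θ

theorem IsDiscreteNorm.zpow_inj {D : Type*} [NormedDivisionRing D] {θ : ℝ}
    (hθ : IsDiscreteNorm D θ) {m n : ℤ} : θ ^ m = θ ^ n ↔ m = n :=
  zpow_right_inj₀ hθ.pos hθ.lt_one.ne

/-- `ρ` is an involutive ring anti-automorphism. -/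
structure IsInvolution {D : Type*} [Ring D] (ρ : D → D) : Prop where
  map_add : ∀ x y, ρ (x + y) = ρ x + ρ y
  map_mul : ∀ x y, ρ (x * y) = ρ y * ρ x
  involutive : ∀ x, ρ (ρ x) = x

namespace IsInvolution

variable {D : Type*} [DivisionRing D] {ρ : D → D}

theorem map_zero (hρ : IsInvolution ρ) : ρ 0 = 0 := by
  have := hρ.map_add 0 0
  simpa using this

theorem map_one (hρ : IsInvolution ρ) : ρ 1 = 1 := by
  have := hρ.map_mul 1 (ρ 1)
  simpa [hρ.involutive] using this.symm

theorem map_neg (hρ : IsInvolution ρ) (x : D) : ρ (-x) = -ρ x := by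
  have := hρ.map_add x (-x)
  rw [add_neg_cancel, hρ.map_zero] at this
  exact (neg_eq_of_add_eq_zero_right this.symm).symm

theorem map_sub (hρ : IsInvolution ρ) (x y : D) : ρ (x - y) = ρ x - ρ y := by
  rw [sub_eq_add_neg, hρ.map_add, hρ.map_neg, sub_eq_add_neg]

theorem map_eq_zero_iff (hρ : IsInvolution ρ) {x : D} : ρ x = 0 ↔ x = 0 := by
  refine ⟨fun h => ?_, fun h => by rw [h, hρ.map_zero]⟩
  rw [← hρ.involutive x, h, hρ.map_zero]

theorem map_pow (hρ : IsInvolution ρ) (x : D) (n : ℕ) : ρ (x ^ n) = ρ x ^ n := by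
  induction n with
  | zero => simp [hρ.map_one]
  | succ n ih => rw [pow_succ, hρ.map_mul, ih, pow_succ']

theorem map_inv (hρ : IsInvolution ρ) (x : D) : ρ x⁻¹ = (ρ x)⁻¹ := by
  rcases eq_or_ne x 0 with rfl | hx
  · simp [hρ.map_zero]
  · refine eq_inv_of_mul_eq_one_left ?_
    rw [← hρ.map_mul, mul_inv_cancel₀ hx, hρ.map_one]

theorem map_zpow (hρ : IsInvolution ρ) (x : D) (n : ℤ) : ρ (x ^ n) = ρ x ^ n := by
  cases n with
  | ofNat n => simpa using hρ.map_pow x n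
  | negSucc n => simp [zpow_negSucc, hρ.map_inv, hρ.map_pow]

theorem map_two_inv (hρ : IsInvolution ρ) : ρ 2⁻¹ = 2⁻¹ := by
  rw [hρ.map_inv, ← one_add_one_eq_two, hρ.map_add, hρ.map_one]

end IsInvolution

section NormedDivisionRing

variable {D : Type*} [NormedDivisionRing D] [IsUltrametricDist D]

theorem norm_add_le_of_le {x y : D} {r : ℝ} (hx : ‖x‖ ≤ r) (hy : ‖y‖ ≤ r) : ‖x + y‖ ≤ r :=
  (IsUltrametricDist.norm_add_le_max x y).trans (max_le hx hy)

theorem norm_sub_le_of_le {x y : D} {r : ℝ} (hx : ‖x‖ ≤ r) (hy : ‖y‖ ≤ r) : ‖x - y‖ ≤ r := by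
  rw [sub_eq_add_neg]
  exact norm_add_le_of_le hx (by rwa [norm_neg])

theorem norm_add_eq_left_of_lt {x y : D} (h : ‖y‖ < ‖x‖) : ‖x + y‖ = ‖x‖ := by
  rw [IsUltrametricDist.norm_add_eq_max_of_norm_ne_norm h.ne', max_eq_left h.le]

variable [CompleteSpace D]

theorem exists_sq_eq_one_add (h2 : ‖(2 : D)‖ = 1) {x : D} (hx : ‖x‖ < 1) :
    ∃ y : D, ‖y‖ < 1 ∧ (1 + y) ^ 2 = 1 + x := by
  have h2' : (2 : D) ≠ 0 := by
    intro h
    rw [h, norm_zero] at h2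
    exact zero_ne_one h2
  have h2i : ‖(2 : D)⁻¹‖ = 1 := by rw [norm_inv, h2, inv_one]
  obtain ⟨y, hy, hfix⟩ := exists_fixedPoint_of_lipschitz (fun y : D => 2⁻¹ * (x - y * y))
    ‖x‖ ‖x‖ (norm_nonneg _) (norm_nonneg _) hx
    (by
      intro y hy
      rw [norm_mul, h2i, one_mul]
      refine norm_sub_le_of_le le_rfl ?_
      rw [norm_mul]
      nlinarith [norm_nonneg y])
    (by
      intro y z hy hz
      have e : (2 : D)⁻¹ * (x - y * y) - 2⁻¹ * (x - z * z)
          = -(2⁻¹ * (y * (y - z) + (y - z) * z)) := by noncomm_ring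
      rw [e, norm_neg, norm_mul, h2i, one_mul]
      refine norm_add_le_of_le ?_ ?_
      · rw [norm_mul]; gcongr
      · rw [norm_mul, mul_comm]; gcongr)
  refine ⟨y, hy.trans_lt hx, ?_⟩
  have : x - y * y = 2 * y := by
    conv_rhs => rw [← hfix]
    rw [mul_inv_cancel_left₀ h2']
  rw [sub_eq_iff_eq_add.1 this]
  noncomm_ring

theorem exists_pow_eq_one_add (h2 : ‖(2 : D)‖ = 1) (n : ℕ) {x : D} (hx : ‖x‖ < 1) :
    ∃ y : D, ‖y‖ < 1 ∧ (1 + y) ^ (2 ^ n) = 1 + x := by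
  induction n generalizing x with
  | zero => exact ⟨x, hx, by simp⟩
  | succ n ih =>
    obtain ⟨y, hy, hyx⟩ := exists_sq_eq_one_add h2 hx
    obtain ⟨z, hz, hzy⟩ := ih hy
    exact ⟨z, hz, by rw [pow_succ, pow_mul, hzy, hyx]⟩

variable {θ : ℝ} {ρ : D → D}

theorem IsInvolution.norm_le_one_of_lt (hρ : IsInvolution ρ) (hθ : IsDiscreteNorm D θ)
    (h2 : ‖(2 : D)‖ = 1) {x : D} (hx : ‖x‖ < 1) : ‖ρ x‖ ≤ 1 := by
  have hne : ∀ y : D, ‖y‖ < 1 → ρ (1 + y) ≠ 0 := by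
    intro y hy h
    have h1 : ‖1 + y‖ = ‖(1 : D)‖ := norm_add_eq_left_of_lt (by simpa using hy)
    rw [hρ.map_eq_zero_iff.1 h, norm_zero, norm_one] at h1
    exact zero_ne_one h1
  obtain ⟨m, hm⟩ := hθ.exists_zpow _ (hne x hx)
  have hdvd : ∀ n : ℕ, ((2 : ℤ) ^ n) ∣ m := by
    intro n
    obtain ⟨y, hy, hyx⟩ := exists_pow_eq_one_add h2 n hx
    obtain ⟨k, hk⟩ := hθ.exists_zpow _ (hne y hy)
    rw [← hyx, hρ.map_pow, norm_pow, hk, ← zpow_natCast, ← zpow_mul, hθ.zpow_inj] at hm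
    exact ⟨k, by rw [← hm]; push_cast; ring⟩
  have hm0 : m = 0 := by
    refine Int.eq_zero_of_abs_lt_dvd (hdvd m.natAbs) ?_
    rw [Int.abs_eq_natAbs]
    exact_mod_cast Nat.lt_two_pow_self
  have e : ρ x = ρ (1 + x) - 1 := by rw [hρ.map_add, hρ.map_one]; abel
  rw [e]
  exact norm_sub_le_of_le (by rw [hm, hm0, zpow_zero]) (by simp)

theorem IsInvolution.norm_le_one (hρ : IsInvolution ρ) (hθ : IsDiscreteNorm D θ)
    (h2 : ‖(2 : D)‖ = 1) {x : D} (hx : ‖x‖ ≤ 1) : ‖ρ x‖ ≤ 1 := by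
  by_contra! hlt
  obtain ⟨π, hπ⟩ := hθ.exists_uniformizer
  have hπ0 : π ≠ 0 := by
    rw [← norm_pos_iff, hπ]
    exact hθ.pos
  have hρπ : 0 < ‖ρ π‖ := norm_pos_iff.2 (hρ.map_eq_zero_iff.not.2 hπ0)
  obtain ⟨n, hn⟩ := pow_unbounded_of_one_lt (‖ρ π‖⁻¹) hlt
  have h1 : ‖x ^ n * π‖ < 1 := by
    rw [norm_mul, norm_pow, hπ]
    exact (mul_le_of_le_one_left hθ.pos.le (pow_le_one₀ (norm_nonneg _) hx)).trans_lt hθ.lt_one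
  have h3 := hρ.norm_le_one_of_lt hθ h2 h1
  rw [hρ.map_mul, hρ.map_pow, norm_mul, norm_pow] at h3
  rw [inv_lt_iff_one_lt_mul₀ hρπ] at hn
  linarith

/-- An involution of a complete discretely valued division ring of odd residue
characteristic is an isometry. -/
theorem IsInvolution.norm_map (hρ : IsInvolution ρ) (hθ : IsDiscreteNorm D θ)
    (h2 : ‖(2 : D)‖ = 1) (x : D) : ‖ρ x‖ = ‖x‖ := by
  rcases eq_or_ne x 0 with rfl | hx
  · rw [hρ.map_zero]
  have hunit : ∀ y : D, ‖y‖ = 1 → ‖ρ y‖ = 1 := by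
    intro y hy
    refine le_antisymm (hρ.norm_le_one hθ h2 hy.le) ?_
    have h := hρ.norm_le_one hθ h2 (x := y⁻¹) (by rw [norm_inv, hy, inv_one])
    have hy0 : 0 < ‖ρ y‖ := by
      rw [norm_pos_iff, Ne, hρ.map_eq_zero_iff, ← norm_eq_zero, hy]
      exact one_ne_zero
    rw [hρ.map_inv, norm_inv] at h
    exact (inv_le_one₀ hy0).1 h
  obtain ⟨π, hπ⟩ := hθ.exists_uniformizer
  have hπ0 : π ≠ 0 := by
    rw [← norm_pos_iff, hπ]
    exact hθ.pos
  obtain ⟨k, hk⟩ := hθ.exists_zpow (ρ π) (hρ.map_eq_zero_iff.not.2 hπ0)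
  have hval : ∀ (y : D) (m : ℤ), ‖y‖ = θ ^ m → ‖ρ y‖ = θ ^ (k * m) := by
    intro y m hy
    have h1 := hunit (y * π ^ (-m)) (by
      rw [norm_mul, norm_zpow, hπ, hy, ← zpow_add₀ hθ.pos.ne', add_neg_cancel, zpow_zero])
    rw [hρ.map_mul, hρ.map_zpow, norm_mul, norm_zpow, hk, ← zpow_mul, mul_comm,
      mul_neg, zpow_neg, ← div_eq_mul_inv, div_eq_one_iff_eq
        (zpow_ne_zero _ hθ.pos.ne')] at h1
    exact h1
  have hkk : k * k = 1 := by
    have := hval (ρ π) k hk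
    rw [hρ.involutive, hπ] at this
    rw [← hθ.zpow_inj, ← this, zpow_one]
  have hk1 : k = 1 := by
    rcases Int.eq_one_or_neg_one_of_mul_eq_one hkk with h | h
    · exact h
    · have := hρ.norm_le_one hθ h2 (x := π) (hπ.le.trans hθ.lt_one.le)
      rw [hk, h, zpow_neg_one, inv_le_one₀ hθ.pos] at this
      exact absurd this hθ.lt_one.not_ge
  obtain ⟨m, hm⟩ := hθ.exists_zpow x hx
  rw [hval x m hm, hm, hk1, one_mul]

end NormedDivisionRing

end

section

/-- A separated non-Archimedean norm on an abelian group. -/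
structure IsUltranorm {A : Type*} [AddCommGroup A] (N : A → ℝ) : Prop where
  nonneg : ∀ x, 0 ≤ N x
  eq_zero_iff : ∀ x, N x = 0 ↔ x = 0
  map_neg : ∀ x, N (-x) = N x
  add_le_max : ∀ x y, N (x + y) ≤ max (N x) (N y)

namespace IsUltranorm

variable {A : Type*} [AddCommGroup A] {N : A → ℝ}

theorem map_zero (hN : IsUltranorm N) : N 0 = 0 := (hN.eq_zero_iff 0).2 rfl

theorem pos (hN : IsUltranorm N) {x : A} (hx : x ≠ 0) : 0 < N x :=
  (hN.nonneg x).lt_of_ne fun h => hx ((hN.eq_zero_iff x).1 h.symm)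

theorem add_le (hN : IsUltranorm N) {x y : A} {r : ℝ} (hx : N x ≤ r) (hy : N y ≤ r) :
    N (x + y) ≤ r :=
  (hN.add_le_max x y).trans (max_le hx hy)

theorem sub_le (hN : IsUltranorm N) {x y : A} {r : ℝ} (hx : N x ≤ r) (hy : N y ≤ r) :
    N (x - y) ≤ r := by
  rw [sub_eq_add_neg]
  exact hN.add_le hx (by rwa [hN.map_neg])

theorem sum_le (hN : IsUltranorm N) {ι : Type*} {s : Finset ι} {f : ι → A} {r : ℝ}
    (hr : 0 ≤ r) (hf : ∀ i ∈ s, N (f i) ≤ r) : N (∑ i ∈ s, f i) ≤ r :=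
  Finset.sum_induction f (fun x => N x ≤ r) (fun _ _ => hN.add_le) (by simpa [hN.map_zero])
    hf

theorem sum_lt (hN : IsUltranorm N) {ι : Type*} {s : Finset ι} {f : ι → A} {r : ℝ}
    (hr : 0 < r) (hf : ∀ i ∈ s, N (f i) < r) : N (∑ i ∈ s, f i) < r :=
  Finset.sum_induction f (fun x => N x < r)
    (fun _ _ hx hy => (hN.add_le_max _ _).trans_lt (max_lt hx hy)) (by simpa [hN.map_zero]) hf

theorem add_eq_left (hN : IsUltranorm N) {x y : A} (h : N y < N x) : N (x + y) = N x := by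
  refine le_antisymm (hN.add_le le_rfl h.le) ?_
  by_contra! hlt
  have := hN.add_le_max (x + y) (-y)
  rw [add_neg_cancel_right, hN.map_neg] at this
  exact absurd this (max_lt hlt h).not_ge

end IsUltranorm

variable {D V : Type*} [NormedDivisionRing D] [AddCommGroup V] [Module Dᵐᵒᵖ V]

/-- A norm on a right vector space over a normed division ring. -/
structure IsVectorNorm (N : V → ℝ) : Prop extends IsUltranorm N where
  map_smul : ∀ (a : D) (v : V), N (MulOpposite.op a • v) = N v * ‖a‖

/-- `h` is a non-degenerate `s`-Hermitian form for the involution `ρ`, with `s = ±1`. -/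
structure IsHermitianForm (ρ : D → D) (s : D) (h : V → V → D) : Prop where
  sign : s = 1 ∨ s = -1
  add_left : ∀ v v' w, h (v + v') w = h v w + h v' w
  add_right : ∀ v w w', h v (w + w') = h v w + h v w'
  smul_left : ∀ (a : D) (v w : V), h (MulOpposite.op a • v) w = ρ a * h v w
  smul_right : ∀ (a : D) (v w : V), h v (MulOpposite.op a • w) = h v w * a
  swap : ∀ v w, h v w = s * ρ (h w v)
  nondegenerate : ∀ v, (∀ w, h v w = 0) → v = 0

/-- `N` is a vector space norm which coincides with its dual norm with respect to `h`. -/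
structure IsSelfDualNorm (h : V → V → D) (N : V → ℝ) : Prop
    extends IsVectorNorm (D := D) N where
  norm_le : ∀ v w, ‖h v w‖ ≤ N v * N w
  exists_eq : ∀ v, v ≠ 0 → ∃ w, w ≠ 0 ∧ ‖h v w‖ = N v * N w

namespace IsHermitianForm

variable {ρ : D → D} {s : D} {h : V → V → D}

theorem zero_left (hh : IsHermitianForm ρ s h) (w : V) : h 0 w = 0 := by
  have := hh.add_left 0 0 w
  simpa using this

theorem zero_right (hh : IsHermitianForm ρ s h) (w : V) : h w 0 = 0 := by
  have := hh.add_right w 0 0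
  simpa using this

theorem neg_right (hh : IsHermitianForm ρ s h) (v w : V) : h v (-w) = -h v w := by
  have := hh.add_right v w (-w)
  rw [add_neg_cancel, hh.zero_right] at this
  exact (neg_eq_of_add_eq_zero_right this.symm).symm

theorem sub_right (hh : IsHermitianForm ρ s h) (v w w' : V) :
    h v (w - w') = h v w - h v w' := by
  rw [sub_eq_add_neg, hh.add_right, hh.neg_right, sub_eq_add_neg]

theorem sum_right (hh : IsHermitianForm ρ s h) {ι : Type*} (t : Finset ι) (v : V)
    (f : ι → V) : h v (∑ i ∈ t, f i) = ∑ i ∈ t, h v (f i) := by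
  classical
  induction t using Finset.induction_on with
  | empty => simp [hh.zero_right]
  | insert i t hi ih => rw [Finset.sum_insert hi, Finset.sum_insert hi, hh.add_right, ih]

theorem sign_mul_self (hh : IsHermitianForm ρ s h) : s * s = 1 := by
  rcases hh.sign with rfl | rfl <;> simp

theorem sign_comm (hh : IsHermitianForm ρ s h) (x : D) : s * x = x * s := by
  rcases hh.sign with rfl | rfl <;> simp

theorem norm_sign (hh : IsHermitianForm ρ s h) : ‖s‖ = 1 := by
  rcases hh.sign with rfl | rfl <;> simp

theorem norm_swap (hh : IsHermitianForm ρ s h) (hρ : ∀ x, ‖ρ x‖ = ‖x‖) (v w : V) :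
    ‖h v w‖ = ‖h w v‖ := by
  rw [hh.swap, norm_mul, hh.norm_sign, one_mul, hρ]

theorem eq_zero_comm (hh : IsHermitianForm ρ s h) (hρ : IsInvolution ρ) {v w : V}
    (h0 : h v w = 0) : h w v = 0 := by
  rw [hh.swap, h0, hρ.map_zero, mul_zero]

/-- Completeness makes a vector isotropic by a small correction. -/
theorem exists_isotropic [CompleteSpace D] [IsUltrametricDist D]
    (hh : IsHermitianForm ρ s h) (hρ : IsInvolution ρ)
    (hρn : ∀ x, ‖ρ x‖ = ‖x‖) (h2 : ‖(2 : D)‖ = 1) {v w : V} {R K : ℝ} (hR : 0 ≤ R)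
    (hK0 : 0 ≤ K) (hK : K < 1) (hu : h v w ≠ 0) (hv : ‖h v v‖ ≤ R * ‖h v w‖)
    (hw : R * ‖h w w‖ ≤ K * ‖h v w‖) :
    ∃ a : D, ‖a‖ ≤ R ∧ h (v + MulOpposite.op a • w) (v + MulOpposite.op a • w) = 0 := by
  have h2' : (2 : D) ≠ 0 := by
    intro h
    rw [h, norm_zero] at h2
    exact zero_ne_one h2
  have h2i : ‖(2 : D)⁻¹‖ = 1 := by rw [norm_inv, h2, inv_one]
  have hu' : 0 < ‖h v w‖ := norm_pos_iff.2 hu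
  obtain ⟨a, ha, hfix⟩ := exists_fixedPoint_of_lipschitz
    (fun a : D => -((h v w)⁻¹ * (2⁻¹ * (h v v + ρ a * h w w * a)))) R K hR hK0 hK
    (by
      intro a ha
      rw [norm_neg, norm_mul, norm_mul, h2i, one_mul, norm_inv, inv_mul_le_iff₀ hu',
        mul_comm _ R]
      refine norm_add_le_of_le hv ?_
      rw [norm_mul, norm_mul, hρn]
      calc ‖a‖ * ‖h w w‖ * ‖a‖ ≤ R * ‖h w w‖ * R := by gcongr
        _ ≤ K * ‖h v w‖ * R := by gcongr
        _ ≤ 1 * ‖h v w‖ * R := by gcongr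
        _ = R * ‖h v w‖ := by ring)
    (by
      intro a b ha hb
      have e : -((h v w)⁻¹ * (2⁻¹ * (h v v + ρ a * h w w * a)))
          - -((h v w)⁻¹ * (2⁻¹ * (h v v + ρ b * h w w * b)))
          = -((h v w)⁻¹ * (2⁻¹ * (ρ (a - b) * h w w * a + ρ b * h w w * (a - b)))) := by
        rw [hρ.map_sub]; noncomm_ring
      rw [e, norm_neg, norm_mul, norm_mul, h2i, one_mul, norm_inv, inv_mul_le_iff₀ hu']
      have hb' : R * ‖h w w‖ * ‖a - b‖ ≤ ‖h v w‖ * (K * ‖a - b‖) := by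
        calc _ ≤ K * ‖h v w‖ * ‖a - b‖ := by gcongr
          _ = _ := by ring
      refine norm_add_le_of_le ?_ ?_ <;> rw [norm_mul, norm_mul, hρn] <;> refine le_trans ?_ hb'
      · calc ‖a - b‖ * ‖h w w‖ * ‖a‖ ≤ ‖a - b‖ * ‖h w w‖ * R := by gcongr
          _ = _ := by ring
      · gcongr)
  refine ⟨a, ha, ?_⟩
  set B := h v v + ρ a * h w w * a with hB
  have hBs : s * ρ B = B := by
    rw [hB, hρ.map_add, hρ.map_mul, hρ.map_mul, hρ.involutive, mul_add, ← hh.swap, ← mul_assoc,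
      hh.sign_comm, mul_assoc, ← mul_assoc s, ← hh.swap, mul_assoc]
  have hcomm : (2 : D)⁻¹ * B = B * 2⁻¹ :=
    ((Nat.cast_commute 2 B).inv_left₀ : Commute ((2 : ℕ) : D)⁻¹ B).eq
  have hua : h v w * a = -(2⁻¹ * B) := by
    conv_lhs => rw [← hfix]
    rw [mul_neg, mul_inv_cancel_left₀ hu]
  have hau : ρ a * h w v = -(2⁻¹ * B) := by
    rw [hh.swap, ← mul_assoc, ← hh.sign_comm, mul_assoc, ← hρ.map_mul, hua, hρ.map_neg,
      hρ.map_mul, hρ.map_two_inv, mul_neg, ← mul_assoc, hBs, hcomm]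
  have hhalf : (2 : D)⁻¹ * B + 2⁻¹ * B = B := by
    rw [← two_mul, mul_inv_cancel_left₀ h2']
  rw [hh.add_left, hh.add_right, hh.add_right, hh.smul_left, hh.smul_left, hh.smul_right,
    hh.smul_right, hua, hau, ← mul_assoc]
  calc _ = B - (2⁻¹ * B + 2⁻¹ * B) := by rw [hB]; abel
    _ = 0 := by rw [hhalf, sub_self]

end IsHermitianForm

end

section

variable {D V : Type*} [NormedDivisionRing D] [AddCommGroup V] [Module Dᵐᵒᵖ V]
  {ρ : D → D} {s : D} {h : V → V → D} {N N' : V → ℝ}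

/-- If the ratio `N' / N` of two self-dual norms has a maximum `C > 1` on a subspace on which
both norms are self-dual, then this subspace contains a hyperbolic pair adapted to both norms. -/
theorem exists_hyperbolic_pair [CompleteSpace D] [IsUltrametricDist D]
    (hh : IsHermitianForm ρ s h) (hρ : IsInvolution ρ)
    (hρn : ∀ x, ‖ρ x‖ = ‖x‖) (h2 : ‖(2 : D)‖ = 1)
    (hN : IsSelfDualNorm h N) (hN' : IsSelfDualNorm h N') (W : Submodule Dᵐᵒᵖ V)
    (hW : ∀ v ∈ W, v ≠ 0 → ∃ w ∈ W, w ≠ 0 ∧ ‖h v w‖ = N v * N w)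
    (hW' : ∀ v ∈ W, v ≠ 0 → ∃ w ∈ W, w ≠ 0 ∧ ‖h v w‖ = N' v * N' w)
    {C : ℝ} (hC : 1 < C) {v : V} (hvW : v ∈ W) (hv0 : v ≠ 0) (hvC : N' v = C * N v)
    (hmax : ∀ x ∈ W, N' x ≤ C * N x) :
    ∃ x ∈ W, ∃ y ∈ W, h x x = 0 ∧ h y y = 0 ∧ h x y = 1 ∧
      N x * N y = 1 ∧ N' x * N' y = 1 := by
  have hC0 : 0 < C := one_pos.trans hC
  have hmax' : ∀ x ∈ W, N x ≤ C * N' x := by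
    intro x hx
    rcases eq_or_ne x 0 with rfl | hx0
    · simp [hN.map_zero, hN'.map_zero]
    obtain ⟨y, hy, hy0, hxy⟩ := hW x hx hx0
    have h1 := hN'.norm_le x y
    have h3 := hN.pos hy0
    rw [hxy] at h1
    refine le_of_mul_le_mul_right ?_ h3
    calc N x * N y ≤ N' x * N' y := h1
      _ ≤ N' x * (C * N y) := by gcongr; exacts [hN'.nonneg x, hmax y hy]
      _ = _ := by ring
  obtain ⟨w, hwW, hw0, hvw'⟩ := hW' v hvW hv0
  have hNv := hN.pos hv0
  have hNw := hN.pos hw0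
  have hNv' := hN'.pos hv0
  have hNw' := hN'.pos hw0
  have hwC : N w = C * N' w := by
    refine le_antisymm (hmax' w hwW) ?_
    have h1 := hN.norm_le v w
    rw [hvw', hvC] at h1
    refine le_of_mul_le_mul_left ?_ hNv
    linarith
  have hvw : ‖h v w‖ = N v * N w := by rw [hvw', hvC, hwC]; ring
  have hu : h v w ≠ 0 := by
    rw [← norm_pos_iff, hvw]
    positivity
  -- make `v` isotropic
  have hww := hN'.norm_le w w
  obtain ⟨a, ha, hiso⟩ := hh.exists_isotropic hρ hρn h2 (v := v) (w := w) (R := N v / N w)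
    (K := (C ^ 2)⁻¹) (by positivity) (by positivity)
    (inv_lt_one_of_one_lt₀ (one_lt_pow₀ hC two_ne_zero)) hu
    (by
      rw [hvw, div_mul_eq_mul_div, le_div_iff₀ hNw]
      calc ‖h v v‖ * N w ≤ (N v * N v) * N w := by gcongr; exact hN.norm_le v v
        _ = _ := by ring)
    (by
      rw [hvw]
      calc N v / N w * ‖h w w‖ ≤ N v / N w * (N' w * N' w) := by gcongr
        _ = _ := by rw [hwC]; field_simp)
  set v₁ := v + MulOpposite.op a • w with hv₁
  have hv₁W : v₁ ∈ W := W.add_mem hvW (W.smul_mem _ hwW)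
  have hv₁N' : N' v₁ = N' v := by
    refine hN'.add_eq_left ?_
    rw [hN'.map_smul]
    calc N' w * ‖a‖ ≤ N' w * (N v / N w) := by gcongr
      _ = N v / C := by rw [hwC]; field_simp
      _ < N' v := by
        rw [hvC, div_lt_iff₀ hC0]
        nlinarith [mul_pos hNv hC0]
  have hv₁N : N v₁ = N v := by
    refine le_antisymm (hN.add_le le_rfl ?_) ?_
    · rw [hN.map_smul]
      calc N w * ‖a‖ ≤ N w * (N v / N w) := by gcongr
        _ = N v := by field_simp
    · refine le_of_mul_le_mul_left ?_ hC0
      rw [← hvC, ← hv₁N']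
      exact hmax _ hv₁W
  have hv₁w : ‖h v₁ w‖ = N v * N w := by
    rw [← hvw, hv₁, hh.add_left, hh.smul_left]
    refine norm_add_eq_left_of_lt ?_
    rw [norm_mul, hρn, hvw]
    calc ‖a‖ * ‖h w w‖ ≤ N v / N w * (N' w * N' w) := by gcongr
      _ = N v * N w / C ^ 2 := by rw [hwC]; field_simp
      _ < N v * N w := div_lt_self (by positivity) (one_lt_pow₀ hC two_ne_zero)
  have hwv₁ : ‖h w v₁‖ = N v * N w := by rw [hh.norm_swap hρn, hv₁w]
  have hu₁ : h w v₁ ≠ 0 := by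
    rw [← norm_pos_iff, hwv₁]
    positivity
  -- make `w` isotropic
  obtain ⟨b, hb, hiso'⟩ := hh.exists_isotropic hρ hρn h2 (v := w) (w := v₁)
    (R := N' w / N' v) (K := 0) (by positivity) le_rfl one_pos hu₁
    (by
      rw [hwv₁, hvC]
      calc ‖h w w‖ ≤ N' w * N' w := hww
        _ = _ := by rw [hwC]; field_simp)
    (by rw [hiso]; simp)
  set w₁ := w + MulOpposite.op b • v₁ with hw₁
  have hw₁W : w₁ ∈ W := W.add_mem hwW (W.smul_mem _ hv₁W)
  have hw₁N : N w₁ = N w := by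
    refine hN.add_eq_left ?_
    rw [hN.map_smul, hv₁N]
    calc N v * ‖b‖ ≤ N v * (N' w / N' v) := by gcongr
      _ = N' w / C := by rw [hvC]; field_simp
      _ < N w := by
        rw [hwC, div_lt_iff₀ hC0]
        nlinarith [mul_pos hNw' hC0]
  have hw₁N' : N' w₁ = N' w := by
    refine le_antisymm (hN'.add_le le_rfl ?_) ?_
    · rw [hN'.map_smul, hv₁N']
      calc N' v * ‖b‖ ≤ N' v * (N' w / N' v) := by gcongr
        _ = N' w := by field_simp
    · refine le_of_mul_le_mul_left ?_ hC0
      rw [← hwC, ← hw₁N]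
      exact hmax' _ hw₁W
  have hv₁w₁ : h v₁ w₁ = h v₁ w := by
    rw [hw₁, hh.add_right, hh.smul_right, hiso, zero_mul, add_zero]
  have hu₂ : h v₁ w₁ ≠ 0 := by
    rw [← norm_pos_iff, hv₁w₁, hv₁w]
    positivity
  refine ⟨v₁, hv₁W, MulOpposite.op (h v₁ w₁)⁻¹ • w₁, W.smul_mem _ hw₁W, hiso, ?_, ?_, ?_, ?_⟩
  · rw [hh.smul_left, hh.smul_right, hiso', zero_mul, mul_zero]
  · rw [hh.smul_right, mul_inv_cancel₀ hu₂]
  · rw [hN.map_smul, hv₁N, hw₁N, norm_inv, hv₁w₁, hv₁w]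
    field_simp
  · rw [hN'.map_smul, hv₁N', hw₁N', norm_inv, hv₁w₁, hv₁w, ← hvw, hvw']
    field_simp

/-- The values of a norm on a finite-dimensional space lie in finitely many
geometric progressions. -/
theorem IsVectorNorm.exists_finite_values [Module.Finite Dᵐᵒᵖ V] {θ : ℝ}
    (hθ : IsDiscreteNorm D θ) (hN : IsVectorNorm (D := D) N) :
    ∃ G : Set ℝ, G.Finite ∧ (∀ g ∈ G, 0 < g) ∧
      ∀ v, v ≠ 0 → ∃ g ∈ G, ∃ m : ℤ, N v = g * θ ^ m := by
  classical
  let S : Setoid {v : V // v ≠ 0} :=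
    { r := fun v w => ∃ m : ℤ, N v = N w * θ ^ m
      iseqv := by
        refine ⟨fun v => ⟨0, by simp⟩, ?_, ?_⟩
        · rintro v w ⟨m, hm⟩
          refine ⟨-m, ?_⟩
          rw [hm, mul_assoc, ← zpow_add₀ hθ.pos.ne', add_neg_cancel, zpow_zero, mul_one]
        · rintro v w x ⟨m, hm⟩ ⟨n, hn⟩
          exact ⟨n + m, by rw [hm, hn, mul_assoc, ← zpow_add₀ hθ.pos.ne']⟩ }
  let e : Quotient S → V := fun c => (c.out : V)
  have hli : LinearIndependent Dᵐᵒᵖ e := by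
    rw [linearIndependent_iff']
    intro t g hg i hi
    by_contra hgi
    obtain ⟨j, hj, hjmax⟩ := t.exists_max_image (fun j => N (g j • e j)) ⟨i, hi⟩
    have hne : ∀ c, e c ≠ 0 := fun c => c.out.2
    have hpos : 0 < N (g j • e j) :=
      (hN.pos (smul_ne_zero hgi (hne i))).trans_le (hjmax i hi)
    have hval : ∀ c, N (g c • e c) = N (e c) * ‖(g c).unop‖ := fun c => by
      rw [← hN.map_smul, MulOpposite.op_unop]
    have hnorm : ∀ c, 0 < N (g c • e c) → ∃ m : ℤ, ‖(g c).unop‖ = θ ^ m := by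
      intro c hc
      refine hθ.exists_zpow _ fun h0 => ?_
      rw [hval, h0, norm_zero, mul_zero] at hc
      exact lt_irrefl _ hc
    have hlt : ∀ c ∈ t.erase j, N (g c • e c) < N (g j • e j) := by
      intro c hc
      obtain ⟨hcj, hct⟩ := Finset.mem_erase.1 hc
      refine (hjmax c hct).lt_of_ne fun heq => hcj ?_
      obtain ⟨m, hm⟩ := hnorm c (heq ▸ hpos)
      obtain ⟨n, hn⟩ := hnorm j hpos
      rw [hval, hval, hm, hn] at heq
      rw [← Quotient.out_equiv_out]
      refine ⟨n + -m, ?_⟩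
      rw [zpow_add₀ hθ.pos.ne', ← mul_assoc]
      change N (e c) = N (e j) * θ ^ n * θ ^ (-m)
      rw [← heq, mul_assoc, ← zpow_add₀ hθ.pos.ne', add_neg_cancel, zpow_zero, mul_one]
    have hs := hN.sum_lt hpos hlt
    rw [← Finset.add_sum_erase t _ hj, add_eq_zero_iff_eq_neg] at hg
    rw [hg, hN.map_neg] at hs
    exact lt_irrefl _ hs
  have : Finite (Quotient S) := hli.finite
  refine ⟨Set.range fun c => N (e c), Set.finite_range _, ?_, ?_⟩
  · rintro _ ⟨c, rfl⟩
    exact hN.pos c.out.2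
  · intro v hv
    obtain ⟨m, hm⟩ : S ⟨v, hv⟩ (Quotient.out (⟦⟨v, hv⟩⟧ : Quotient S)) :=
      Setoid.symm (Quotient.mk_out (s := S) ⟨v, hv⟩)
    exact ⟨_, ⟨⟦⟨v, hv⟩⟧, rfl⟩, m, hm⟩

/-- The ratio of two norms attains its maximum on every non-zero subset. -/
theorem exists_max_ratio [Module.Finite Dᵐᵒᵖ V] {θ : ℝ}
    (hθ : IsDiscreteNorm D θ) (hN : IsVectorNorm (D := D) N) (hN' : IsVectorNorm (D := D) N')
    {B : ℝ} (hB : ∀ v, N' v ≤ B * N v) (W : Set V) {v₀ : V} (hv₀ : v₀ ∈ W) (h0 : v₀ ≠ 0) :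
    ∃ v ∈ W, v ≠ 0 ∧ ∀ x ∈ W, N' x ≤ N' v / N v * N x := by
  obtain ⟨G, hGf, hG, hGv⟩ := hN.exists_finite_values hθ
  obtain ⟨G', hGf', hG', hGv'⟩ := hN'.exists_finite_values hθ
  have hfin := finite_window hθ.pos hθ.lt_one (hGf'.image2 (fun x y => x / y) hGf)
    (by rintro _ ⟨x, hx, y, hy, rfl⟩; exact div_pos (hG' x hx) (hG y hy))
    (a := N' v₀ / N v₀) (b := B) (div_pos (hN'.pos h0) (hN.pos h0))
  have hsub : (fun v => N' v / N v) '' {v | v ∈ W ∧ v ≠ 0 ∧ N' v₀ / N v₀ ≤ N' v / N v} ⊆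
      {x : ℝ | N' v₀ / N v₀ ≤ x ∧ x ≤ B ∧
        ∃ g ∈ Set.image2 (fun x y => x / y) G' G, ∃ m : ℤ, x = g * θ ^ m} := by
    rintro _ ⟨v, ⟨hvW, hv, hle⟩, rfl⟩
    obtain ⟨g, hg, m, hm⟩ := hGv v hv
    obtain ⟨g', hg', m', hm'⟩ := hGv' v hv
    refine ⟨hle, (div_le_iff₀ (hN.pos hv)).2 (hB v), _, ⟨g', hg', g, hg, rfl⟩, m' - m, ?_⟩
    simp only [hm, hm']
    rw [zpow_sub₀ hθ.pos.ne', mul_div_mul_comm]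
  obtain ⟨_, ⟨v, ⟨hvW, hv, hle⟩, rfl⟩, hmax⟩ :=
    (hfin.subset hsub).exists_maximal (Set.Nonempty.image _ ⟨v₀, hv₀, h0, le_rfl⟩)
  refine ⟨v, hvW, hv, fun x hx => ?_⟩
  rcases eq_or_ne x 0 with rfl | hx0
  · simp [hN.map_zero, hN'.map_zero]
  rw [← div_le_iff₀ (hN.pos hx0)]
  by_contra! hlt
  exact hlt.not_ge (hmax ⟨x, ⟨hx, hx0, hle.trans hlt.le⟩, rfl⟩ hlt.le)

end

section

variable {D V : Type*} [NormedDivisionRing D] [AddCommGroup V] [Module Dᵐᵒᵖ V]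
  {ρ : D → D} {s : D} {h : V → V → D} {N N' : V → ℝ} {n : ℕ}

/-- The vectors `e i`, `f i` span an orthogonal sum of hyperbolic planes. -/
structure IsHyperbolicSystem (h : V → V → D) (e f : Fin n → V) : Prop where
  left_left : ∀ i j, h (e i) (e j) = 0
  right_right : ∀ i j, h (f i) (f j) = 0
  left_right : ∀ i j, h (e i) (f j) = if i = j then 1 else 0

/-- The linear combination of a hyperbolic system with given coefficients. -/
def hyperbolicSum (e f : Fin n → V) (a b : Fin n → D) : V :=
  ∑ i, (MulOpposite.op (a i) • e i + MulOpposite.op (b i) • f i)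

/-- The projection onto the orthogonal complement of a hyperbolic system. -/
def complementProj (s : D) (h : V → V → D) (e f : Fin n → V) (x : V) : V :=
  x - hyperbolicSum e f (fun i => s * h (f i) x) (fun i => h (e i) x)

/-- The orthogonal complement of a hyperbolic system. -/
def hyperbolicComplement (hh : IsHermitianForm ρ s h) (e f : Fin n → V) :
    Submodule Dᵐᵒᵖ V where
  carrier := {x | ∀ i, h (e i) x = 0 ∧ h (f i) x = 0}
  add_mem' hx hy i := by
    simp [hh.add_right, (hx i).1, (hx i).2, (hy i).1, (hy i).2]
  zero_mem' i := by simp [hh.zero_right]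
  smul_mem' c x hx i := by
    rw [← MulOpposite.op_unop c, hh.smul_right, hh.smul_right, (hx i).1, (hx i).2]
    simp

theorem hyperbolicSum_add_complementProj (s : D) (h : V → V → D) (e f : Fin n → V) (x : V) :
    hyperbolicSum e f (fun i => s * h (f i) x) (fun i => h (e i) x)
      + complementProj s h e f x = x := by
  simp [complementProj]

theorem complementProj_add (hh : IsHermitianForm ρ s h) (e f : Fin n → V) (x y : V) :
    complementProj s h e f (x + y) = complementProj s h e f x + complementProj s h e f y := by
  simp only [complementProj, hyperbolicSum, hh.add_right, mul_add, MulOpposite.op_add, add_smul,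
    Finset.sum_add_distrib]
  abel

theorem complementProj_smul (hh : IsHermitianForm ρ s h) (e f : Fin n → V) (c : D) (x : V) :
    complementProj s h e f (MulOpposite.op c • x)
      = MulOpposite.op c • complementProj s h e f x := by
  simp only [complementProj, hyperbolicSum, hh.smul_right, ← mul_assoc, MulOpposite.op_mul,
    mul_smul, smul_sub, Finset.smul_sum, smul_add]

theorem hyperbolicSum_left (hh : IsHermitianForm ρ s h) (e f : Fin n → V) (a b : Fin n → D)
    (y : V) : h (hyperbolicSum e f a b) y = ∑ i, (ρ (a i) * h (e i) y + ρ (b i) * h (f i) y) := by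
  have : ∀ t : Finset (Fin n),
      h (∑ i ∈ t, (MulOpposite.op (a i) • e i + MulOpposite.op (b i) • f i)) y
        = ∑ i ∈ t, (ρ (a i) * h (e i) y + ρ (b i) * h (f i) y) := by
    intro t
    induction t using Finset.induction_on with
    | empty => simp [hh.zero_left]
    | insert i t hi ih =>
      rw [Finset.sum_insert hi, Finset.sum_insert hi, hh.add_left, ih, hh.add_left,
        hh.smul_left, hh.smul_left]
  exact this _

namespace IsHyperbolicSystem

variable {e f e' f' : Fin n → V}

theorem right_left (he : IsHyperbolicSystem h e f) (hh : IsHermitianForm ρ s h)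
    (hρ : IsInvolution ρ) (i j : Fin n) : h (f i) (e j) = if i = j then s else 0 := by
  rw [hh.swap, he.left_right]
  by_cases hij : i = j
  · simp [hij, hρ.map_one]
  · simp [hij, Ne.symm hij, hρ.map_zero]

theorem left_hyperbolicSum (he : IsHyperbolicSystem h e f) (hh : IsHermitianForm ρ s h)
    (a b : Fin n → D) (j : Fin n) : h (e j) (hyperbolicSum e f a b) = b j := by
  simp [hyperbolicSum, hh.sum_right, hh.add_right, hh.smul_right, he.left_left, he.left_right]

theorem right_hyperbolicSum (he : IsHyperbolicSystem h e f) (hh : IsHermitianForm ρ s h)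
    (hρ : IsInvolution ρ) (a b : Fin n → D) (j : Fin n) :
    h (f j) (hyperbolicSum e f a b) = s * a j := by
  simp [hyperbolicSum, hh.sum_right, hh.add_right, hh.smul_right, he.right_right,
    he.right_left hh hρ]

theorem complementProj_mem (he : IsHyperbolicSystem h e f) (hh : IsHermitianForm ρ s h)
    (hρ : IsInvolution ρ) (x : V) :
    complementProj s h e f x ∈ hyperbolicComplement hh e f := by
  intro i
  constructor
  · rw [complementProj, hh.sub_right, he.left_hyperbolicSum hh, sub_self]
  · rw [complementProj, hh.sub_right, he.right_hyperbolicSum hh hρ, ← mul_assoc,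
      hh.sign_mul_self, one_mul, sub_self]

theorem left_add (he : IsHyperbolicSystem h e f) (hh : IsHermitianForm ρ s h)
    (a b : Fin n → D) {z : V} (hz : z ∈ hyperbolicComplement hh e f) (j : Fin n) :
    h (e j) (hyperbolicSum e f a b + z) = b j := by
  rw [hh.add_right, he.left_hyperbolicSum hh, (hz j).1, add_zero]

theorem right_add (he : IsHyperbolicSystem h e f) (hh : IsHermitianForm ρ s h)
    (hρ : IsInvolution ρ) (a b : Fin n → D) {z : V} (hz : z ∈ hyperbolicComplement hh e f)
    (j : Fin n) : h (f j) (hyperbolicSum e f a b + z) = s * a j := by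
  rw [hh.add_right, he.right_hyperbolicSum hh hρ, (hz j).2, add_zero]

theorem complementProj_sum_add (he : IsHyperbolicSystem h e f) (hh : IsHermitianForm ρ s h)
    (hρ : IsInvolution ρ) (a b : Fin n → D) {z : V} (hz : z ∈ hyperbolicComplement hh e f) :
    complementProj s h e f (hyperbolicSum e f a b + z) = z := by
  simp only [complementProj, he.left_add hh a b hz, he.right_add hh hρ a b hz, ← mul_assoc,
    hh.sign_mul_self, one_mul, add_sub_cancel_left]

theorem complement_left (hh : IsHermitianForm ρ s h) (hρ : IsInvolution ρ)
    {z : V} (hz : z ∈ hyperbolicComplement hh e f) (a b : Fin n → D) :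
    h z (hyperbolicSum e f a b) = 0 := by
  simp [hyperbolicSum, hh.sum_right, hh.add_right, hh.smul_right,
    hh.eq_zero_comm hρ (hz _).1, hh.eq_zero_comm hρ (hz _).2]

theorem linearIndependent_left (he : IsHyperbolicSystem h e f) (hh : IsHermitianForm ρ s h)
    (hρ : IsInvolution ρ) : LinearIndependent Dᵐᵒᵖ e := by
  rw [Fintype.linearIndependent_iff]
  intro g hg i
  have h1 : hyperbolicSum e f (fun i => (g i).unop) 0 = 0 := by simpa [hyperbolicSum] using hg
  have h3 := he.right_hyperbolicSum hh hρ (fun i => (g i).unop) 0 i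
  rw [h1, hh.zero_right] at h3
  have h4 : (g i).unop = 0 := by
    rw [← one_mul (g i).unop, ← hh.sign_mul_self, mul_assoc, ← h3, mul_zero]
  simpa using h4

theorem norm_right_mul_le (hN : IsSelfDualNorm h N) (heN : ∀ i, N (e i) * N (f i) = 1)
    (i : Fin n) (x : V) : ‖h (f i) x‖ * N (e i) ≤ N x := by
  calc _ ≤ N (f i) * N x * N (e i) := by
        gcongr
        exacts [hN.nonneg _, hN.norm_le _ _]
    _ = N x * (N (e i) * N (f i)) := by ring
    _ = N x := by rw [heN, mul_one]

theorem norm_left_mul_le (hN : IsSelfDualNorm h N) (heN : ∀ i, N (e i) * N (f i) = 1)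
    (i : Fin n) (x : V) : ‖h (e i) x‖ * N (f i) ≤ N x := by
  calc _ ≤ N (e i) * N x * N (f i) := by
        gcongr
        exacts [hN.nonneg _, hN.norm_le _ _]
    _ = N x * (N (e i) * N (f i)) := by ring
    _ = N x := by rw [heN, mul_one]

theorem hyperbolicSum_le (hh : IsHermitianForm ρ s h) (hN : IsSelfDualNorm h N)
    {x : V} {r : ℝ} (hr : 0 ≤ r) (h1 : ∀ i, ‖h (f i) x‖ * N (e i) ≤ r)
    (h3 : ∀ i, ‖h (e i) x‖ * N (f i) ≤ r) :
    N (hyperbolicSum e f (fun i => s * h (f i) x) (fun i => h (e i) x)) ≤ r := by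
  refine hN.sum_le hr fun i _ => hN.add_le ?_ ?_
  · rw [hN.map_smul, norm_mul, hh.norm_sign, one_mul, mul_comm]
    exact h1 i
  · rw [hN.map_smul, mul_comm]
    exact h3 i

theorem complementProj_le (hh : IsHermitianForm ρ s h) (hN : IsSelfDualNorm h N)
    (heN : ∀ i, N (e i) * N (f i) = 1) (x : V) : N (complementProj s h e f x) ≤ N x :=
  hN.sub_le le_rfl <| hyperbolicSum_le hh hN (hN.nonneg x)
    (fun i => norm_right_mul_le hN heN i x) (fun i => norm_left_mul_le hN heN i x)

/-- A self-dual norm splits along an adapted hyperbolic system. -/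
theorem norm_le_iff (hh : IsHermitianForm ρ s h) (hN : IsSelfDualNorm h N)
    (heN : ∀ i, N (e i) * N (f i) = 1) (x : V) (r : ℝ) :
    N x ≤ r ↔ (∀ i, ‖h (f i) x‖ * N (e i) ≤ r) ∧ (∀ i, ‖h (e i) x‖ * N (f i) ≤ r) ∧
      N (complementProj s h e f x) ≤ r := by
  refine ⟨fun hx => ⟨fun i => (norm_right_mul_le hN heN i x).trans hx,
    fun i => (norm_left_mul_le hN heN i x).trans hx, (complementProj_le hh hN heN x).trans hx⟩, ?_⟩
  rintro ⟨h1, h3, h4⟩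
  rw [← hyperbolicSum_add_complementProj s h e f x]
  exact hN.add_le (hyperbolicSum_le hh hN ((hN.nonneg _).trans h4) h1 h3) h4

theorem norm_lt_iff (hh : IsHermitianForm ρ s h) (hN : IsSelfDualNorm h N)
    (heN : ∀ i, N (e i) * N (f i) = 1) (x : V) (r : ℝ) :
    N x < r ↔ (∀ i, ‖h (f i) x‖ * N (e i) < r) ∧ (∀ i, ‖h (e i) x‖ * N (f i) < r) ∧
      N (complementProj s h e f x) < r := by
  refine ⟨fun hx => ⟨fun i => (norm_right_mul_le hN heN i x).trans_lt hx,
    fun i => (norm_left_mul_le hN heN i x).trans_lt hx,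
    (complementProj_le hh hN heN x).trans_lt hx⟩, ?_⟩
  rintro ⟨h1, h3, h4⟩
  have hr : 0 < r := (hN.nonneg _).trans_lt h4
  rw [← hyperbolicSum_add_complementProj s h e f x]
  refine (hN.add_le_max _ _).trans_lt (max_lt (hN.sum_lt hr fun i _ => ?_) h4)
  refine (hN.add_le_max _ _).trans_lt (max_lt ?_ ?_)
  · rw [hN.map_smul, norm_mul, hh.norm_sign, one_mul, mul_comm]
    exact h1 i
  · rw [hN.map_smul, mul_comm]
    exact h3 i

/-- The restriction of a self-dual norm to the complement of an adapted hyperbolic system is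
self-dual. -/
theorem exists_eq_complement (he : IsHyperbolicSystem h e f) (hh : IsHermitianForm ρ s h)
    (hρ : IsInvolution ρ) (hN : IsSelfDualNorm h N) (heN : ∀ i, N (e i) * N (f i) = 1)
    {v : V} (hv : v ∈ hyperbolicComplement hh e f) (hv0 : v ≠ 0) :
    ∃ w ∈ hyperbolicComplement hh e f, w ≠ 0 ∧ ‖h v w‖ = N v * N w := by
  obtain ⟨w, hw0, hw⟩ := hN.exists_eq v hv0
  have h1 : h v (complementProj s h e f w) = h v w := by
    rw [complementProj, hh.sub_right, complement_left hh hρ hv, sub_zero]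
  have h3 := complementProj_le hh hN heN w
  refine ⟨_, he.complementProj_mem hh hρ w, fun h0 => ?_, ?_⟩
  · rw [h0, hh.zero_right] at h1
    rw [← h1, norm_zero] at hw
    exact (mul_pos (hN.pos hv0) (hN.pos hw0)).ne hw
  · refine le_antisymm (hN.norm_le _ _) ?_
    rw [h1, hw]
    exact mul_le_mul_of_nonneg_left h3 (hN.nonneg v)

/-- Two self-dual norms have a common adapted hyperbolic system on whose complement they
agree. -/
theorem exists_common [CompleteSpace D] [IsUltrametricDist D] [Module.Finite Dᵐᵒᵖ V] {θ : ℝ}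
    (hθ : IsDiscreteNorm D θ) (hh : IsHermitianForm ρ s h) (hρ : IsInvolution ρ)
    (h2 : ‖(2 : D)‖ = 1) (hN : IsSelfDualNorm h N) (hN' : IsSelfDualNorm h N')
    {B : ℝ} (hB : ∀ v, N' v ≤ B * N v) :
    ∃ (n : ℕ) (e f : Fin n → V), IsHyperbolicSystem h e f ∧ (∀ i, N (e i) * N (f i) = 1) ∧
      (∀ i, N' (e i) * N' (f i) = 1) ∧ ∀ x ∈ hyperbolicComplement hh e f, N' x = N x := by
  by_contra! hcon
  have hall : ∀ n : ℕ, ∃ e f : Fin n → V, IsHyperbolicSystem h e f ∧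
      (∀ i, N (e i) * N (f i) = 1) ∧ (∀ i, N' (e i) * N' (f i) = 1) := by
    intro n
    induction n with
    | zero => exact ⟨Fin.elim0, Fin.elim0, ⟨fun i => i.elim0, fun i => i.elim0, fun i => i.elim0⟩,
        fun i => i.elim0, fun i => i.elim0⟩
    | succ n ih =>
      obtain ⟨e, f, he, heN, heN'⟩ := ih
      obtain ⟨x, hxW, hx⟩ := hcon n e f he heN heN'
      have hW := fun v hv hv0 => he.exists_eq_complement hh hρ hN heN (v := v) hv hv0
      have hW' := fun v hv hv0 => he.exists_eq_complement hh hρ hN' heN' (v := v) hv hv0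
      obtain ⟨y, hyW, hy⟩ : ∃ y ∈ hyperbolicComplement hh e f, N y < N' y := by
        rcases lt_or_gt_of_ne hx with hlt | hlt
        · have hx0 : x ≠ 0 := by
            rintro rfl
            simp [hN.map_zero, hN'.map_zero] at hlt
          obtain ⟨w, hw, hw0, hxw⟩ := hW x hxW hx0
          refine ⟨w, hw, ?_⟩
          have h1 := hN'.norm_le x w
          rw [hxw] at h1
          refine lt_of_mul_lt_mul_left (h1.trans_lt ?_) (hN.nonneg x)
          exact mul_lt_mul_of_pos_right hlt (hN'.pos hw0)
        · exact ⟨x, hxW, hlt⟩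
      have hy0 : y ≠ 0 := by
        rintro rfl
        simp [hN.map_zero, hN'.map_zero] at hy
      obtain ⟨v, hv, hv0, hmax⟩ := exists_max_ratio hθ hN.toIsVectorNorm hN'.toIsVectorNorm hB
        (hyperbolicComplement hh e f : Set V) hyW hy0
      have hC : 1 < N' v / N v := by
        refine lt_of_mul_lt_mul_right ?_ (hN.nonneg y)
        rw [one_mul]
        exact hy.trans_le (hmax y hyW)
      obtain ⟨a, ha, b, hb, haa, hbb, hab, habN, habN'⟩ := exists_hyperbolic_pair hh hρ
        (hρ.norm_map hθ h2) h2 hN hN' (hyperbolicComplement hh e f) hW hW' hC hv hv0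
        (div_mul_cancel₀ _ (hN.pos hv0).ne').symm hmax
      refine ⟨Fin.cons a e, Fin.cons b f, ⟨?_, ?_, ?_⟩, ?_, ?_⟩
      · simp only [Fin.forall_fin_succ, Fin.cons_zero, Fin.cons_succ]
        exact ⟨⟨haa, fun i => hh.eq_zero_comm hρ (ha i).1⟩, fun i => ⟨(ha i).1, he.left_left i⟩⟩
      · simp only [Fin.forall_fin_succ, Fin.cons_zero, Fin.cons_succ]
        exact ⟨⟨hbb, fun i => hh.eq_zero_comm hρ (hb i).2⟩, fun i => ⟨(hb i).2, he.right_right i⟩⟩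
      · simp only [Fin.forall_fin_succ, Fin.cons_zero, Fin.cons_succ, hab, if_true,
          Fin.succ_inj, he.left_right, (hb _).1, hh.eq_zero_comm hρ (ha _).2]
        simp [Fin.succ_ne_zero, (Fin.succ_ne_zero _).symm]
      · simpa only [Fin.forall_fin_succ, Fin.cons_zero, Fin.cons_succ] using ⟨habN, heN⟩
      · simpa only [Fin.forall_fin_succ, Fin.cons_zero, Fin.cons_succ] using ⟨habN', heN'⟩
  obtain ⟨e, f, he, -⟩ := hall (Module.finrank Dᵐᵒᵖ V + 1)
  have := (he.linearIndependent_left hh hρ).fintype_card_le_finrank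
  simp at this

/-- The isometry carrying one hyperbolic system to another one with the same complement. -/
theorem exists_isometry [Module.Finite Dᵐᵒᵖ V]
    (he : IsHyperbolicSystem h e f) (he' : IsHyperbolicSystem h e' f')
    (hh : IsHermitianForm ρ s h) (hρ : IsInvolution ρ)
    (hN : IsSelfDualNorm h N) (hN' : IsSelfDualNorm h N')
    (heN : ∀ i, N (e i) * N (f i) = 1) (heN' : ∀ i, N' (e' i) * N' (f' i) = 1)
    (hee' : ∀ i, N' (e' i) = N (e i))
    (hW : ∀ x ∈ hyperbolicComplement hh e f, x ∈ hyperbolicComplement hh e' f')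
    (hNW : ∀ x ∈ hyperbolicComplement hh e f, N' x = N x) :
    ∃ g : V ≃ₗ[Dᵐᵒᵖ] V, (∀ v w, h (g v) (g w) = h v w) ∧ ∀ v, N' (g v) = N v := by
  let g : V →ₗ[Dᵐᵒᵖ] V :=
    { toFun := fun x => hyperbolicSum e' f' (fun i => s * h (f i) x) (fun i => h (e i) x)
        + complementProj s h e f x
      map_add' := fun x y => by
        rw [complementProj_add hh]
        simp only [hyperbolicSum, hh.add_right, mul_add, MulOpposite.op_add, add_smul,
          Finset.sum_add_distrib]
        abel
      map_smul' := fun c x => by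
        rw [← MulOpposite.op_unop c, complementProj_smul hh]
        simp only [hyperbolicSum, hh.smul_right, ← mul_assoc, MulOpposite.op_mul,
          mul_smul, Finset.smul_sum, smul_add, RingHom.id_apply] }
  have hg : ∀ x, g x = hyperbolicSum e' f' (fun i => s * h (f i) x) (fun i => h (e i) x)
        + complementProj s h e f x := fun _ => rfl
  have hmem := he.complementProj_mem hh hρ
  have hmem' := fun x => hW _ (hmem x)
  have hgl : ∀ j x, h (e' j) (g x) = h (e j) x := fun j x => by
    rw [hg, he'.left_add hh _ _ (hmem' x)]
  have hgr : ∀ j x, h (f' j) (g x) = h (f j) x := fun j x => by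
    rw [hg, he'.right_add hh hρ _ _ (hmem' x), ← mul_assoc, hh.sign_mul_self, one_mul]
  have hgp : ∀ x, complementProj s h e' f' (g x) = complementProj s h e f x := fun x => by
    rw [hg, he'.complementProj_sum_add hh hρ _ _ (hmem' x)]
  have hiso : ∀ v w, h (g v) (g w) = h v w := by
    intro v w
    conv_lhs => rw [hg v, hh.add_left, hyperbolicSum_left hh]
    conv_rhs => rw [← hyperbolicSum_add_complementProj s h e f v, hh.add_left,
      hyperbolicSum_left hh]
    simp only [hgl, hgr]
    congr 1
    rw [hg w, hh.add_right, complement_left hh hρ (hmem' v), zero_add]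
    conv_rhs => rw [← hyperbolicSum_add_complementProj s h e f w, hh.add_right,
      complement_left hh hρ (hmem v), zero_add]
  have hff' : ∀ i, N' (f' i) = N (f i) := by
    intro i
    have h1 := heN' i
    rw [hee', ← heN i] at h1
    refine mul_left_cancel₀ (fun h0 => ?_) h1
    have := heN i
    rw [h0, zero_mul] at this
    exact zero_ne_one this
  have hgN : ∀ v, N' (g v) = N v := by
    have key : ∀ v r, N' (g v) ≤ r ↔ N v ≤ r := by
      intro v r
      rw [norm_le_iff hh hN' heN', norm_le_iff hh hN heN]
      simp only [hgl, hgr, hgp, hee', hff', hNW _ (hmem v)]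
    exact fun v => le_antisymm ((key v _).2 le_rfl) ((key v _).1 le_rfl)
  have hinj : Function.Injective g := by
    rw [injective_iff_map_eq_zero]
    intro v hv
    refine hh.nondegenerate v fun w => ?_
    rw [← hiso, hv, hh.zero_left]
  exact ⟨LinearEquiv.ofInjectiveEndo g hinj, hiso, hgN⟩

/-- Permuting, rescaling and flipping the planes of a hyperbolic system. -/
theorem exists_adapted {θ : ℝ} (hθ : IsDiscreteNorm D θ)
    (he : IsHyperbolicSystem h e f) (hh : IsHermitianForm ρ s h) (hρ : IsInvolution ρ)
    (hρn : ∀ x, ‖ρ x‖ = ‖x‖) (hN' : IsSelfDualNorm h N')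
    (heN' : ∀ i, N' (e i) * N' (f i) = 1)
    (σ : Equiv.Perm (Fin n))
    (hσ : ∀ i, ∃ m : ℤ, N (e i) = N' (e (σ i)) * θ ^ m ∨ N (e i) = N' (f (σ i)) * θ ^ m) :
    ∃ e' f' : Fin n → V, IsHyperbolicSystem h e' f' ∧ (∀ i, N' (e' i) * N' (f' i) = 1) ∧
      (∀ i, N' (e' i) = N (e i)) ∧
      ∀ x ∈ hyperbolicComplement hh e f, x ∈ hyperbolicComplement hh e' f' := by
  have hex : ∀ i, ∃ p q : V, (∃ c : D, p = MulOpposite.op c • e (σ i) ∨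
        p = MulOpposite.op c • f (σ i)) ∧
      (∃ c : D, q = MulOpposite.op c • e (σ i) ∨ q = MulOpposite.op c • f (σ i)) ∧
      h p p = 0 ∧ h q q = 0 ∧ h p q = 1 ∧ N' p * N' q = 1 ∧ N' p = N (e i) := by
    intro i
    obtain ⟨π, hπ⟩ := hθ.exists_uniformizer
    have hπ0 : π ≠ 0 := by
      rw [← norm_pos_iff, hπ]
      exact hθ.pos
    obtain ⟨m, hm⟩ := hσ i
    have hc : ‖π ^ m‖ = θ ^ m := by rw [norm_zpow, hπ]
    set c := π ^ m with hc'
    have hc0 : c ≠ 0 := zpow_ne_zero _ hπ0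
    have hρc : ρ c ≠ 0 := hρ.map_eq_zero_iff.not.2 hc0
    have hθm : θ ^ m ≠ 0 := zpow_ne_zero _ hθ.pos.ne'
    rcases hm with hm | hm
    · refine ⟨MulOpposite.op c • e (σ i), MulOpposite.op (ρ c)⁻¹ • f (σ i), ⟨_, Or.inl rfl⟩,
        ⟨_, Or.inr rfl⟩, ?_, ?_, ?_, ?_, ?_⟩
      · rw [hh.smul_left, hh.smul_right, he.left_left, zero_mul, mul_zero]
      · rw [hh.smul_left, hh.smul_right, he.right_right, zero_mul, mul_zero]
      · rw [hh.smul_left, hh.smul_right, he.left_right, if_pos rfl, one_mul, mul_inv_cancel₀ hρc]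
      · rw [hN'.map_smul, hN'.map_smul, norm_inv, hρn, hc]
        field_simp
        exact heN' _
      · rw [hN'.map_smul, hc, hm]
    · refine ⟨MulOpposite.op c • f (σ i), MulOpposite.op (s * (ρ c)⁻¹) • e (σ i),
        ⟨_, Or.inr rfl⟩, ⟨_, Or.inl rfl⟩, ?_, ?_, ?_, ?_, ?_⟩
      · rw [hh.smul_left, hh.smul_right, he.right_right, zero_mul, mul_zero]
      · rw [hh.smul_left, hh.smul_right, he.left_left, zero_mul, mul_zero]
      · rw [hh.smul_left, hh.smul_right, he.right_left hh hρ, if_pos rfl, ← mul_assoc s,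
          hh.sign_mul_self, one_mul, mul_inv_cancel₀ hρc]
      · rw [hN'.map_smul, hN'.map_smul, norm_mul, hh.norm_sign, one_mul, norm_inv, hρn, hc]
        field_simp
        rw [mul_comm]
        exact heN' _
      · rw [hN'.map_smul, hc, hm]
  choose p q hp hq hpp hqq hpq hpqN hpN using hex
  have horth : ∀ i j, i ≠ j → ∀ x y : V, (∃ c : D, x = MulOpposite.op c • e (σ i) ∨
        x = MulOpposite.op c • f (σ i)) → (∃ c : D, y = MulOpposite.op c • e (σ j) ∨
        y = MulOpposite.op c • f (σ j)) → h x y = 0 := by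
    rintro i j hij x y ⟨c, rfl | rfl⟩ ⟨c', rfl | rfl⟩ <;>
      simp [hh.smul_left, hh.smul_right, he.left_left, he.right_right, he.left_right,
        he.right_left hh hρ, hij]
  have hcompl : ∀ i, ∀ x ∈ hyperbolicComplement hh e f, ∀ y : V,
      (∃ c : D, y = MulOpposite.op c • e (σ i) ∨ y = MulOpposite.op c • f (σ i)) →
        h y x = 0 := by
    rintro i x hx y ⟨c, rfl | rfl⟩
    · rw [hh.smul_left, (hx _).1, mul_zero]
    · rw [hh.smul_left, (hx _).2, mul_zero]
  refine ⟨p, q, ⟨fun i j => ?_, fun i j => ?_, fun i j => ?_⟩, hpqN, hpN,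
    fun x hx i => ⟨hcompl i x hx _ (hp i), hcompl i x hx _ (hq i)⟩⟩
  · rcases eq_or_ne i j with rfl | hij
    exacts [hpp i, horth i j hij _ _ (hp i) (hp j)]
  · rcases eq_or_ne i j with rfl | hij
    exacts [hqq i, horth i j hij _ _ (hq i) (hq j)]
  · rcases eq_or_ne i j with rfl | hij
    · rw [if_pos rfl, hpq]
    · rw [if_neg hij]
      exact horth i j hij _ _ (hp i) (hq j)

end IsHyperbolicSystem

end

section

theorem relIndex_prod {A B : Type*} [AddGroup A] [AddGroup B] (H K : AddSubgroup A)
    (H' K' : AddSubgroup B) :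
    (H.prod H').relIndex (K.prod K') = H.relIndex K * H'.relIndex K' := by
  have e : (H.prod H').addSubgroupOf (K.prod K') = AddSubgroup.comap
      (AddSubgroup.prodEquiv K K').toAddMonoidHom
        ((H.addSubgroupOf K).prod (H'.addSubgroupOf K')) := by
    ext x
    rfl
  rw [AddSubgroup.relIndex, e,
    AddSubgroup.index_comap_of_surjective _ (AddSubgroup.prodEquiv K K').surjective,
    AddSubgroup.index_prod]
  rfl

theorem relIndex_pi {ι : Type*} [Fintype ι] {A : ι → Type*} [∀ i, AddGroup (A i)]
    (H K : ∀ i, AddSubgroup (A i)) :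
    (AddSubgroup.pi Set.univ H).relIndex (AddSubgroup.pi Set.univ K)
      = ∏ i, (H i).relIndex (K i) := by
  let φ : AddSubgroup.pi Set.univ K →+ ∀ i, K i :=
    AddMonoidHom.mk' (fun x i => ⟨x.1 i, x.2 i (Set.mem_univ i)⟩) fun _ _ => rfl
  have hφ : Function.Surjective φ := fun y => ⟨⟨fun i => y i, fun i _ => (y i).2⟩, rfl⟩
  have e : (AddSubgroup.pi Set.univ H).addSubgroupOf (AddSubgroup.pi Set.univ K)
      = AddSubgroup.comap φ (AddSubgroup.pi Set.univ fun i => (H i).addSubgroupOf (K i)) := by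
    ext x
    rfl
  rw [AddSubgroup.relIndex, e, AddSubgroup.index_comap_of_surjective _ hφ]
  simp_rw [AddSubgroup.relIndex, AddSubgroup.index, ← Nat.card_pi]
  refine Nat.card_congr
    ((Quotient.congrRight fun x y => ?_).trans (Setoid.piQuotientEquiv _).symm)
  rw [QuotientAddGroup.leftRel_pi]

section Balls

variable {A : Type*} [AddCommGroup A] {N : A → ℝ}

/-- The closed ball of radius `exp (-t)`. -/
def IsUltranorm.closedBall (hN : IsUltranorm N) (t : ℝ) : AddSubgroup A where
  carrier := {x | N x ≤ Real.exp (-t)}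
  add_mem' hx hy := hN.add_le hx hy
  zero_mem' := by simpa [hN.map_zero] using (Real.exp_pos _).le
  neg_mem' {x} hx := by simpa [hN.map_neg] using hx

/-- The open ball of radius `exp (-t)`. -/
def IsUltranorm.openBall (hN : IsUltranorm N) (t : ℝ) : AddSubgroup A where
  carrier := {x | N x < Real.exp (-t)}
  add_mem' hx hy := (hN.add_le_max _ _).trans_lt (max_lt hx hy)
  zero_mem' := by simpa [hN.map_zero] using Real.exp_pos _
  neg_mem' {x} hx := by simpa [hN.map_neg] using hx

/-- The index of the open ball of radius `exp (-t)` in the closed ball of the same radius. -/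
def IsUltranorm.jump (hN : IsUltranorm N) (t : ℝ) : ℕ :=
  (hN.openBall t).relIndex (hN.closedBall t)

theorem IsUltranorm.mem_closedBall (hN : IsUltranorm N) {t : ℝ} {x : A} :
    x ∈ hN.closedBall t ↔ N x ≤ Real.exp (-t) := Iff.rfl

theorem IsUltranorm.mem_openBall (hN : IsUltranorm N) {t : ℝ} {x : A} :
    x ∈ hN.openBall t ↔ N x < Real.exp (-t) := Iff.rfl

theorem IsUltranorm.restrict {R : Type*} [Ring R] [Module R A] (hN : IsUltranorm N)
    (W : Submodule R A) : IsUltranorm fun x : W => N x where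
  nonneg _ := hN.nonneg _
  eq_zero_iff x := by rw [hN.eq_zero_iff, ZeroMemClass.coe_eq_zero]
  map_neg _ := hN.map_neg _
  add_le_max _ _ := hN.add_le_max _ _

end Balls

section Scaled

variable {D : Type*} [NormedDivisionRing D] [IsUltrametricDist D] {θ : ℝ}

variable (D) in
theorem isUltranorm_norm : IsUltranorm (norm : D → ℝ) where
  nonneg := norm_nonneg
  eq_zero_iff _ := norm_eq_zero
  map_neg := norm_neg
  add_le_max := IsUltrametricDist.norm_add_le_max

variable (D) in
/-- The norm of a division ring multiplied by a positive constant. -/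
theorem isUltranorm_norm_mul {a : ℝ} (ha : 0 < a) : IsUltranorm fun x : D => ‖x‖ * a where
  nonneg x := by positivity
  eq_zero_iff x := by simp [ha.ne']
  map_neg x := by rw [norm_neg]
  add_le_max x y := by
    rw [← max_mul_of_nonneg _ _ ha.le]
    exact mul_le_mul_of_nonneg_right (IsUltrametricDist.norm_add_le_max x y) ha.le

/-- The class modulo `log θ` of the logarithm of a positive real number. -/
def logClass (θ a : ℝ) : ℝ ⧸ AddSubgroup.zmultiples (Real.log θ) :=
  QuotientAddGroup.mk (Real.log a)

theorem logClass_eq_iff (hθ : 0 < θ) {a b : ℝ} (ha : 0 < a) (hb : 0 < b) :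
    logClass θ a = logClass θ b ↔ ∃ m : ℤ, b = a * θ ^ m := by
  rw [logClass, logClass, QuotientAddGroup.eq, AddSubgroup.mem_zmultiples_iff]
  refine exists_congr fun m => ?_
  have h1 : 0 < a * θ ^ m := mul_pos ha (zpow_pos hθ m)
  rw [← Real.log_injOn_pos.eq_iff (Set.mem_Ioi.2 hb) (Set.mem_Ioi.2 h1),
    Real.log_mul ha.ne' (zpow_pos hθ m).ne', Real.log_zpow, zsmul_eq_mul]
  constructor <;> intro h <;> linarith

theorem logClass_inv (a : ℝ) : logClass θ a⁻¹ = -logClass θ a := by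
  rw [logClass, logClass, Real.log_inv, QuotientAddGroup.mk_neg]

open Classical in
theorem jump_norm_mul (hθ : IsDiscreteNorm D θ) {a : ℝ} (ha : 0 < a) (t : ℝ) :
    (isUltranorm_norm_mul D ha).jump t
      = if logClass θ a = logClass θ (Real.exp (-t)) then
          (isUltranorm_norm D).jump 0 else 1 := by
  split_ifs with hc
  · rw [logClass_eq_iff hθ.pos ha (Real.exp_pos _)] at hc
    obtain ⟨m, hm⟩ := hc
    obtain ⟨π, hπ⟩ := hθ.exists_uniformizer
    have hπ0 : π ≠ 0 := by
      rw [← norm_pos_iff, hπ]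
      exact hθ.pos
    have hc : ‖π ^ m‖ = θ ^ m := by rw [norm_zpow, hπ]
    have hc0 : π ^ m ≠ 0 := zpow_ne_zero _ hπ0
    have hθm : 0 < θ ^ m := zpow_pos hθ.pos m
    have hinj : Function.Injective (AddMonoidHom.mulLeft (π ^ m)) := fun x y h =>
      mul_left_cancel₀ hc0 h
    have hbij : Function.Bijective (AddMonoidHom.mulLeft (π ^ m)) :=
      ⟨hinj, fun y => ⟨(π ^ m)⁻¹ * y, by simp [mul_inv_cancel_left₀ hc0]⟩⟩
    have hopen : (isUltranorm_norm D).openBall 0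
        = ((isUltranorm_norm_mul D ha).openBall t).comap (AddMonoidHom.mulLeft (π ^ m)) := by
      ext x
      rw [AddSubgroup.mem_comap, IsUltranorm.mem_openBall, IsUltranorm.mem_openBall,
        AddMonoidHom.coe_mulLeft, norm_mul, hc, hm, mul_comm (θ ^ m), mul_assoc, mul_comm a,
        mul_lt_iff_lt_one_left (by positivity)]
      simp
    have hclosed : (isUltranorm_norm D).closedBall 0
        = ((isUltranorm_norm_mul D ha).closedBall t).comap (AddMonoidHom.mulLeft (π ^ m)) := by
      ext x
      rw [AddSubgroup.mem_comap, IsUltranorm.mem_closedBall, IsUltranorm.mem_closedBall,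
        AddMonoidHom.coe_mulLeft, norm_mul, hc, hm, mul_comm (θ ^ m), mul_assoc, mul_comm a,
        mul_le_iff_le_one_left (by positivity)]
      simp
    rw [IsUltranorm.jump, IsUltranorm.jump, hopen, AddSubgroup.relIndex_comap, hclosed,
      AddSubgroup.map_comap_eq_self_of_surjective hbij.2]
  · rw [IsUltranorm.jump, AddSubgroup.relIndex_eq_one]
    intro x hx
    rw [IsUltranorm.mem_closedBall] at hx
    rw [IsUltranorm.mem_openBall]
    refine hx.lt_of_ne fun hxt => hc ?_
    have hx0 : x ≠ 0 := by
      rintro rfl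
      rw [norm_zero, zero_mul] at hxt
      exact (Real.exp_pos _).ne hxt
    obtain ⟨m, hm⟩ := hθ.exists_zpow x hx0
    rw [logClass_eq_iff hθ.pos ha (Real.exp_pos _)]
    exact ⟨m, by rw [← hxt, hm, mul_comm]⟩

end Scaled

variable {D V : Type*} [NormedDivisionRing D] [IsUltrametricDist D] [AddCommGroup V]
  [Module Dᵐᵒᵖ V] {ρ : D → D} {s : D} {h : V → V → D} {N N' : V → ℝ} {n : ℕ}

namespace IsHyperbolicSystem

variable {e f : Fin n → V}

/-- The index of open balls in closed balls is multiplicative along the splitting defined by a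
hyperbolic system. -/
theorem jump_eq (he : IsHyperbolicSystem h e f) (hh : IsHermitianForm ρ s h)
    (hρ : IsInvolution ρ) (hN : IsSelfDualNorm h N) (heN : ∀ i, N (e i) * N (f i) = 1)
    (he0 : ∀ i, 0 < N (e i)) (hf0 : ∀ i, 0 < N (f i)) (t : ℝ) :
    hN.toIsUltranorm.jump t
      = (∏ i, (isUltranorm_norm_mul D (he0 i)).jump t)
        * ((∏ i, (isUltranorm_norm_mul D (hf0 i)).jump t)
          * (hN.toIsUltranorm.restrict (hyperbolicComplement hh e f)).jump t) := by
  have hWN := hN.toIsUltranorm.restrict (hyperbolicComplement hh e f)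
  let φ : V →+ (Fin n → D) × (Fin n → D) × hyperbolicComplement hh e f :=
    AddMonoidHom.mk' (fun x => (fun i => h (f i) x, fun i => h (e i) x,
        ⟨complementProj s h e f x, he.complementProj_mem hh hρ x⟩))
      (by
        intro x y
        refine Prod.ext (funext fun i => ?_) (Prod.ext (funext fun i => ?_) (Subtype.ext ?_))
        · exact hh.add_right _ _ _
        · exact hh.add_right _ _ _
        · exact complementProj_add hh e f x y)
  have hφ : Function.Surjective φ := by
    rintro ⟨a, b, z⟩
    have h1 := he.right_add hh hρ (fun i => s * a i) b z.2
    simp only [← mul_assoc, hh.sign_mul_self, one_mul] at h1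
    exact ⟨hyperbolicSum e f (fun i => s * a i) b + z, Prod.ext (funext h1)
      (Prod.ext (funext (he.left_add hh _ b z.2))
        (Subtype.ext (he.complementProj_sum_add hh hρ _ b z.2)))⟩
  have hopen : hN.toIsUltranorm.openBall t = AddSubgroup.comap φ
      ((AddSubgroup.pi Set.univ fun i => (isUltranorm_norm_mul D (he0 i)).openBall t).prod
        ((AddSubgroup.pi Set.univ fun i => (isUltranorm_norm_mul D (hf0 i)).openBall t).prod
          (hWN.openBall t))) := by
    ext x
    rw [AddSubgroup.mem_comap, AddSubgroup.mem_prod, AddSubgroup.mem_prod, AddSubgroup.mem_pi,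
      AddSubgroup.mem_pi, IsUltranorm.mem_openBall, norm_lt_iff hh hN heN]
    simp only [Set.mem_univ, forall_true_left]
    rfl
  have hclosed : hN.toIsUltranorm.closedBall t = AddSubgroup.comap φ
      ((AddSubgroup.pi Set.univ fun i => (isUltranorm_norm_mul D (he0 i)).closedBall t).prod
        ((AddSubgroup.pi Set.univ fun i => (isUltranorm_norm_mul D (hf0 i)).closedBall t).prod
          (hWN.closedBall t))) := by
    ext x
    rw [AddSubgroup.mem_comap, AddSubgroup.mem_prod, AddSubgroup.mem_prod, AddSubgroup.mem_pi,
      AddSubgroup.mem_pi, IsUltranorm.mem_closedBall, norm_le_iff hh hN heN]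
    simp only [Set.mem_univ, forall_true_left]
    rfl
  rw [IsUltranorm.jump, hopen, AddSubgroup.relIndex_comap, hclosed,
    AddSubgroup.map_comap_eq_self_of_surjective hφ, relIndex_prod, relIndex_prod, relIndex_pi,
    relIndex_pi]
  rfl

open Classical in
/-- Two self-dual norms with the same finite ball indices have, up to permutation, inversion and
scaling, the same values on a common hyperbolic system. -/
theorem exists_perm_of_jump_eq {θ : ℝ} (hθ : IsDiscreteNorm D θ)
    (hq : 1 < (isUltranorm_norm D).jump 0)
    (he : IsHyperbolicSystem h e f) (hh : IsHermitianForm ρ s h) (hρ : IsInvolution ρ)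
    (hN : IsSelfDualNorm h N) (hN' : IsSelfDualNorm h N')
    (heN : ∀ i, N (e i) * N (f i) = 1) (heN' : ∀ i, N' (e i) * N' (f i) = 1)
    (hNW : ∀ x ∈ hyperbolicComplement hh e f, N' x = N x)
    (hjump0 : ∀ t, hN.toIsUltranorm.jump t ≠ 0)
    (hjump : ∀ t, hN.toIsUltranorm.jump t = hN'.toIsUltranorm.jump t) :
    ∃ σ : Equiv.Perm (Fin n), ∀ i,
      ∃ m : ℤ, N (e i) = N' (e (σ i)) * θ ^ m ∨ N (e i) = N' (f (σ i)) * θ ^ m := by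
  have pos_of_mul : ∀ {M : V → ℝ}, IsSelfDualNorm h M → (∀ i, M (e i) * M (f i) = 1) →
      (∀ i, 0 < M (e i)) ∧ ∀ i, 0 < M (f i) := by
    intro M hM heM
    refine ⟨fun i => (hM.nonneg _).lt_of_ne fun h0 => ?_,
      fun i => (hM.nonneg _).lt_of_ne fun h0 => ?_⟩ <;>
    · have := heM i
      simp [← h0] at this
  obtain ⟨he0, hf0⟩ := pos_of_mul hN heN
  obtain ⟨he0', hf0'⟩ := pos_of_mul hN' heN'
  have hfe : ∀ i, N (f i) = (N (e i))⁻¹ := fun i => eq_inv_of_mul_eq_one_right (heN i)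
  have hfe' : ∀ i, N' (f i) = (N' (e i))⁻¹ := fun i => eq_inv_of_mul_eq_one_right (heN' i)
  have hfun : (fun x : hyperbolicComplement hh e f => N' (x : V))
      = fun x : hyperbolicComplement hh e f => N (x : V) :=
    funext fun x => hNW x x.2
  have hcount : ∀ x : ℝ ⧸ AddSubgroup.zmultiples (Real.log θ),
      (Finset.univ.filter fun i => logClass θ (N (e i)) = x).card
        + (Finset.univ.filter fun i => -logClass θ (N (e i)) = x).card
      = (Finset.univ.filter fun i => logClass θ (N' (e i)) = x).card
        + (Finset.univ.filter fun i => -logClass θ (N' (e i)) = x).card := by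
    intro x
    obtain ⟨t, rfl⟩ : ∃ t : ℝ, logClass θ (Real.exp (-t)) = x := by
      obtain ⟨y, rfl⟩ := QuotientAddGroup.mk_surjective x
      exact ⟨-y, by rw [neg_neg, logClass, Real.log_exp]⟩
    have h1 := he.jump_eq hh hρ hN heN he0 hf0 t
    have h2 := he.jump_eq hh hρ hN' heN' he0' hf0' t
    have h3 := hjump0 t
    have h4 := hjump t
    rw [h1] at h3
    rw [h1, h2] at h4
    simp only [hfun] at h4
    rw [← mul_assoc, ← mul_assoc] at h4
    have h5 := Nat.eq_of_mul_eq_mul_right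
      (Nat.pos_of_ne_zero (right_ne_zero_of_mul (right_ne_zero_of_mul h3))) h4
    rw [Finset.prod_congr rfl fun i _ => jump_norm_mul hθ (he0 i) t,
      Finset.prod_congr rfl fun i _ => jump_norm_mul hθ (hf0 i) t,
      Finset.prod_congr rfl fun i _ => jump_norm_mul hθ (he0' i) t,
      Finset.prod_congr rfl fun i _ => jump_norm_mul hθ (hf0' i) t] at h5
    simp only [Finset.prod_ite, Finset.prod_const, one_pow, mul_one,
      ← pow_add, hfe, hfe', logClass_inv] at h5
    exact Nat.pow_right_injective hq h5
  obtain ⟨σ, hσ⟩ := exists_perm_eq_or_eq_neg _ _ hcount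
  refine ⟨σ, fun i => ?_⟩
  rcases hσ i with h1 | h1
  · obtain ⟨m, hm⟩ := (logClass_eq_iff hθ.pos (he0' _) (he0 _)).1 h1
    exact ⟨m, Or.inl hm⟩
  · rw [eq_comm, neg_eq_iff_eq_neg, ← logClass_inv, ← hfe'] at h1
    obtain ⟨m, hm⟩ := (logClass_eq_iff hθ.pos (hf0' _) (he0 _)).1 h1.symm
    exact ⟨m, Or.inr hm⟩

end IsHyperbolicSystem

/-- Two self-dual norms with the same finite ball indices are isometric. -/
theorem exists_isometry_of_jump_eq [CompleteSpace D] [Module.Finite Dᵐᵒᵖ V] {θ : ℝ}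
    (hθ : IsDiscreteNorm D θ) (hq : 1 < (isUltranorm_norm D).jump 0)
    (h2 : ‖(2 : D)‖ = 1) (hh : IsHermitianForm ρ s h) (hρ : IsInvolution ρ)
    (hN : IsSelfDualNorm h N) (hN' : IsSelfDualNorm h N')
    {B : ℝ} (hB : ∀ v, N' v ≤ B * N v)
    (hjump0 : ∀ t, hN.toIsUltranorm.jump t ≠ 0)
    (hjump : ∀ t, hN.toIsUltranorm.jump t = hN'.toIsUltranorm.jump t) :
    ∃ g : V ≃ₗ[Dᵐᵒᵖ] V, (∀ v w, h (g v) (g w) = h v w) ∧ ∀ v, N' (g v) = N v := by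
  obtain ⟨n, e, f, he, heN, heN', hNW⟩ :=
    IsHyperbolicSystem.exists_common hθ hh hρ h2 hN hN' hB
  obtain ⟨σ, hσ⟩ := he.exists_perm_of_jump_eq hθ hq hh hρ hN hN' heN heN' hNW hjump0 hjump
  obtain ⟨e', f', he', he1, he2, hW⟩ := he.exists_adapted hθ hh hρ (hρ.norm_map hθ h2) hN' heN' σ hσ
  exact he.exists_isometry he' hh hρ hN hN' heN he1 he2 hW hNW

end

section

section LatticeFunction

variable {D V : Type*} [NormedDivisionRing D] [AddCommGroup V] [Module Dᵐᵒᵖ V]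
  {ρ : D → D} {s : D} {h : V → V → D} {θ : ℝ} {Λ Λ' : ℝ → AddSubgroup V}

/-- Self-dual lattice functions over a division ring with a multiplicative valuation whose value
group is generated by `θ`. -/
structure IsSelfDualLatticeFunction (θ : ℝ) (h : V → V → D) (Λ : ℝ → AddSubgroup V) : Prop where
  smul_mem : ∀ t, ∀ v ∈ Λ t, ∀ y : D, ‖y‖ ≤ 1 → MulOpposite.op y • v ∈ Λ t
  finitelyGenerated : ∀ t, ∃ S : Finset V, ↑S ⊆ (Λ t : Set V) ∧ ∀ v ∈ Λ t,
    v ∈ AddSubgroup.closure {w : V | ∃ u ∈ S, ∃ y : D, ‖y‖ ≤ 1 ∧ w = MulOpposite.op y • u}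
  span_eq_top : ∀ t, Submodule.span Dᵐᵒᵖ (Λ t : Set V) = ⊤
  antitone : ∀ r t, r ≤ t → Λ t ≤ Λ r
  mem_iff_forall_lt : ∀ t v, v ∈ Λ t ↔ ∀ r < t, v ∈ Λ r
  mem_add_iff : ∀ π : D, ‖π‖ = θ → ∀ t w,
    w ∈ Λ (t - Real.log θ) ↔ ∃ v ∈ Λ t, w = MulOpposite.op π • v
  selfDual : ∀ t v, v ∈ Λ t ↔ ∀ w, (∃ r, -t < r ∧ w ∈ Λ r) → ‖h v w‖ < 1

namespace IsSelfDualLatticeFunction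

theorem smul_mem_iff (hθ : IsDiscreteNorm D θ) (hΛ : IsSelfDualLatticeFunction θ h Λ)
    {c : D} (hc : c ≠ 0) (t : ℝ) (v : V) :
    MulOpposite.op c • v ∈ Λ (t - Real.log ‖c‖) ↔ v ∈ Λ t := by
  obtain ⟨π, hπ⟩ := hθ.exists_uniformizer
  have hπ0 : π ≠ 0 := by
    rw [← norm_pos_iff, hπ]
    exact hθ.pos
  have h1 : ∀ t v, MulOpposite.op π • v ∈ Λ (t - Real.log θ) ↔ v ∈ Λ t := by
    intro t v
    rw [hΛ.mem_add_iff π hπ]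
    constructor
    · rintro ⟨w, hw, hvw⟩
      have h0 : MulOpposite.op π ≠ 0 := by simpa using hπ0
      rwa [smul_right_injective V h0 hvw]
    · exact fun hv => ⟨v, hv, rfl⟩
  have h2 : ∀ (m : ℤ) (t : ℝ) (v : V),
      MulOpposite.op (π ^ m) • v ∈ Λ (t - m * Real.log θ) ↔ v ∈ Λ t := by
    intro m
    induction m using Int.induction_on with
    | zero => simp
    | succ m ih =>
      intro t v
      rw [← ih t v, ← h1 _ (MulOpposite.op (π ^ (m : ℤ)) • v), smul_smul, ← MulOpposite.op_mul,
        ← zpow_add_one₀ hπ0]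
      push_cast
      ring_nf
    | pred m ih =>
      intro t v
      rw [← ih t v, ← h1 _ (MulOpposite.op (π ^ (-(m : ℤ) - 1)) • v), smul_smul,
        ← MulOpposite.op_mul, ← zpow_add_one₀ hπ0]
      push_cast
      ring_nf
  obtain ⟨m, hm⟩ := hθ.exists_zpow c hc
  have hpm : ‖π ^ m‖ = θ ^ m := by rw [norm_zpow, hπ]
  have hpm0 : π ^ m ≠ 0 := zpow_ne_zero _ hπ0
  have hu : ‖c * (π ^ m)⁻¹‖ = 1 := by
    rw [norm_mul, norm_inv, hpm, hm, mul_inv_cancel₀ (zpow_ne_zero _ hθ.pos.ne')]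
  have hu0 : c * (π ^ m)⁻¹ ≠ 0 := mul_ne_zero hc (inv_ne_zero hpm0)
  have hcu : c = c * (π ^ m)⁻¹ * π ^ m := by rw [mul_assoc, inv_mul_cancel₀ hpm0, mul_one]
  rw [hm, Real.log_zpow]
  conv_lhs => rw [hcu, MulOpposite.op_mul, mul_smul]
  rw [h2]
  refine ⟨fun hv => ?_, fun hv => hΛ.smul_mem t v hv _ hu.le⟩
  have h3 := hΛ.smul_mem t _ hv (c * (π ^ m)⁻¹)⁻¹ (by rw [norm_inv, hu, inv_one])
  rwa [smul_smul, ← MulOpposite.op_mul, mul_inv_cancel₀ hu0, MulOpposite.op_one, one_smul] at h3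

theorem exists_mem (hθ : IsDiscreteNorm D θ) (hΛ : IsSelfDualLatticeFunction θ h Λ) (v : V) :
    ∃ r, v ∈ Λ r := by
  have hv : v ∈ Submodule.span Dᵐᵒᵖ (Λ 0 : Set V) := by
    rw [hΛ.span_eq_top]
    trivial
  induction hv using Submodule.span_induction with
  | mem x hx => exact ⟨0, hx⟩
  | zero => exact ⟨0, zero_mem _⟩
  | add x y _ _ hx hy =>
    obtain ⟨a, ha⟩ := hx
    obtain ⟨b, hb⟩ := hy
    exact ⟨min a b, add_mem (hΛ.antitone _ _ (min_le_left a b) ha)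
      (hΛ.antitone _ _ (min_le_right a b) hb)⟩
  | smul c x _ hx =>
    obtain ⟨a, ha⟩ := hx
    by_cases hc : c = 0
    · exact ⟨0, by rw [hc, zero_smul]; exact zero_mem _⟩
    · exact ⟨_, (hΛ.smul_mem_iff hθ (c := c.unop) (by simpa using hc) a x).2 ha⟩

theorem bddAbove (hθ : IsDiscreteNorm D θ) (hh : IsHermitianForm ρ s h)
    (hΛ : IsSelfDualLatticeFunction θ h Λ) {v : V} (hv : v ≠ 0) : BddAbove {t | v ∈ Λ t} := by
  obtain ⟨w, hw⟩ : ∃ w, h v w ≠ 0 := by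
    by_contra! hcon
    exact hv (hh.nondegenerate v hcon)
  obtain ⟨r, hr⟩ := hΛ.exists_mem hθ (MulOpposite.op (h v w)⁻¹ • w)
  refine ⟨-r, fun t ht => ?_⟩
  by_contra! hlt
  have := (hΛ.selfDual t v).1 ht _ ⟨r, by linarith, hr⟩
  rw [hh.smul_right, mul_inv_cancel₀ hw, norm_one] at this
  exact lt_irrefl _ this

end IsSelfDualLatticeFunction

open Classical in
/-- The norm attached to a lattice function. -/
def latticeNorm (Λ : ℝ → AddSubgroup V) (v : V) : ℝ :=
  if v = 0 then 0 else Real.exp (-sSup {t | v ∈ Λ t})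

theorem latticeNorm_nonneg (Λ : ℝ → AddSubgroup V) (v : V) : 0 ≤ latticeNorm Λ v := by
  unfold latticeNorm
  split_ifs
  exacts [le_rfl, (Real.exp_pos _).le]

theorem latticeNorm_eq_zero_iff (Λ : ℝ → AddSubgroup V) (v : V) :
    latticeNorm Λ v = 0 ↔ v = 0 := by
  unfold latticeNorm
  split_ifs with hv <;> simp [hv, Real.exp_ne_zero]

theorem le_of_forall_exp {a b : ℝ} (ha : 0 ≤ a)
    (hab : ∀ t : ℝ, a ≤ Real.exp (-t) → b ≤ Real.exp (-t)) : b ≤ a := by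
  refine le_of_forall_gt_imp_ge_of_dense fun c hc => ?_
  have h0 : 0 < c := ha.trans_lt hc
  have := hab (-Real.log c)
  rw [neg_neg, Real.exp_log h0] at this
  exact this hc.le

namespace IsSelfDualLatticeFunction

theorem mem_iff (hθ : IsDiscreteNorm D θ) (hh : IsHermitianForm ρ s h)
    (hΛ : IsSelfDualLatticeFunction θ h Λ) (t : ℝ) (v : V) :
    v ∈ Λ t ↔ latticeNorm Λ v ≤ Real.exp (-t) := by
  unfold latticeNorm
  split_ifs with hv
  · simp [hv, zero_mem, (Real.exp_pos _).le]
  rw [Real.exp_le_exp, neg_le_neg_iff]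
  refine ⟨fun hvt => le_csSup (hΛ.bddAbove hθ hh hv) hvt, fun ht => ?_⟩
  rw [hΛ.mem_iff_forall_lt]
  intro r hr
  obtain ⟨t', ht', hrt⟩ := exists_lt_of_lt_csSup (hΛ.exists_mem hθ v) (hr.trans_le ht)
  exact hΛ.antitone _ _ hrt.le ht'

theorem isUltranorm (hθ : IsDiscreteNorm D θ) (hh : IsHermitianForm ρ s h)
    (hΛ : IsSelfDualLatticeFunction θ h Λ) : IsUltranorm (latticeNorm Λ) where
  nonneg := latticeNorm_nonneg Λ
  eq_zero_iff := latticeNorm_eq_zero_iff Λ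
  map_neg x := by
    refine le_antisymm ?_ ?_ <;> refine le_of_forall_exp (latticeNorm_nonneg Λ _) fun t ht => ?_ <;>
      rw [← hΛ.mem_iff hθ hh] at ht ⊢
    · exact neg_mem ht
    · exact neg_mem_iff.1 ht
  add_le_max x y := by
    refine le_of_forall_exp (le_max_of_le_left (latticeNorm_nonneg Λ _)) fun t ht => ?_
    rw [max_le_iff, ← hΛ.mem_iff hθ hh, ← hΛ.mem_iff hθ hh] at ht
    rw [← hΛ.mem_iff hθ hh]
    exact add_mem ht.1 ht.2

theorem isVectorNorm (hθ : IsDiscreteNorm D θ) (hh : IsHermitianForm ρ s h)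
    (hΛ : IsSelfDualLatticeFunction θ h Λ) : IsVectorNorm (D := D) (latticeNorm Λ) where
  toIsUltranorm := hΛ.isUltranorm hθ hh
  map_smul a v := by
    by_cases ha : a = 0
    · simp [ha, (hΛ.isUltranorm hθ hh).map_zero]
    have ha' : 0 < ‖a‖ := norm_pos_iff.2 ha
    have key : ∀ t : ℝ, latticeNorm Λ (MulOpposite.op a • v) ≤ Real.exp (-t)
        ↔ latticeNorm Λ v * ‖a‖ ≤ Real.exp (-t) := by
      intro t
      have h1 := hΛ.smul_mem_iff hθ ha (t + Real.log ‖a‖) v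
      rw [add_sub_cancel_right, hΛ.mem_iff hθ hh, hΛ.mem_iff hθ hh, neg_add, Real.exp_add,
        Real.exp_neg (Real.log _), Real.exp_log ha', ← div_eq_mul_inv, le_div_iff₀ ha'] at h1
      exact h1
    exact le_antisymm
      (le_of_forall_exp (mul_nonneg (latticeNorm_nonneg Λ v) ha'.le) fun t => (key t).2)
      (le_of_forall_exp (latticeNorm_nonneg Λ _) fun t => (key t).1)

theorem norm_lt_one (hθ : IsDiscreteNorm D θ) (hh : IsHermitianForm ρ s h)
    (hΛ : IsSelfDualLatticeFunction θ h Λ) {v w : V}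
    (hvw : latticeNorm Λ v * latticeNorm Λ w < 1) : ‖h v w‖ < 1 := by
  by_cases hv : v = 0
  · simp [hv, hh.zero_left]
  by_cases hw : w = 0
  · simp [hw, hh.zero_right]
  have hN := hΛ.isUltranorm hθ hh
  refine (hΛ.selfDual (-Real.log (latticeNorm Λ v)) v).1 ?_ w
    ⟨-Real.log (latticeNorm Λ w), ?_, ?_⟩
  · rw [hΛ.mem_iff hθ hh, neg_neg, Real.exp_log (hN.pos hv)]
  · have h1 := Real.log_lt_log (mul_pos (hN.pos hv) (hN.pos hw)) hvw
    rw [Real.log_one, Real.log_mul (hN.pos hv).ne' (hN.pos hw).ne'] at h1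
    linarith
  · rw [hΛ.mem_iff hθ hh, neg_neg, Real.exp_log (hN.pos hw)]

theorem norm_le (hθ : IsDiscreteNorm D θ) (hh : IsHermitianForm ρ s h)
    (hΛ : IsSelfDualLatticeFunction θ h Λ) (v w : V) :
    ‖h v w‖ ≤ latticeNorm Λ v * latticeNorm Λ w := by
  by_contra! hlt
  have h0 : 0 < ‖h v w‖ :=
    (mul_nonneg (latticeNorm_nonneg Λ v) (latticeNorm_nonneg Λ w)).trans_lt hlt
  have h1 : ‖h v (MulOpposite.op (h v w)⁻¹ • w)‖ < 1 := by
    refine hΛ.norm_lt_one hθ hh ?_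
    rw [(hΛ.isVectorNorm hθ hh).map_smul, norm_inv, ← mul_assoc, ← div_eq_mul_inv,
      div_lt_one h0]
    exact hlt
  rw [hh.smul_right, mul_inv_cancel₀ (norm_pos_iff.1 h0), norm_one] at h1
  exact lt_irrefl _ h1

theorem isSelfDualNorm [Module.Finite Dᵐᵒᵖ V] (hθ : IsDiscreteNorm D θ)
    (hh : IsHermitianForm ρ s h) (hΛ : IsSelfDualLatticeFunction θ h Λ) :
    IsSelfDualNorm h (latticeNorm Λ) where
  toIsVectorNorm := hΛ.isVectorNorm hθ hh
  norm_le := hΛ.norm_le hθ hh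
  exists_eq v hv := by
    have hN := hΛ.isVectorNorm hθ hh
    have ha : 0 < latticeNorm Λ v := hN.pos hv
    set a := latticeNorm Λ v with ha_def
    obtain ⟨G, hG, hGpos, hGval⟩ := hN.exists_finite_values hθ
    have hfin := (finite_window hθ.pos hθ.lt_one hG hGpos (inv_pos.2 ha) (b := 2 * a⁻¹)).subset
      (Set.sdiff_subset (t := {a⁻¹}))
    obtain ⟨δ, hδ, hball⟩ := Metric.isOpen_iff.1 hfin.isClosed.isOpen_compl a⁻¹ (by simp)
    set b := min (a⁻¹ + δ) (2 * a⁻¹) with hb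
    have hai : 0 < a⁻¹ := inv_pos.2 ha
    have hab : a⁻¹ < b := lt_min (by linarith) (by linarith)
    have hb0 : 0 < b := hai.trans hab
    have hvb : v ∉ Λ (Real.log b) := by
      rw [hΛ.mem_iff hθ hh, Real.exp_neg, Real.exp_log hb0, not_le]
      exact inv_lt_of_inv_lt₀ ha hab
    rw [hΛ.selfDual] at hvb
    push Not at hvb
    obtain ⟨w, ⟨r, hr, hw⟩, hvw⟩ := hvb
    rw [hΛ.mem_iff hθ hh] at hw
    have hwb : latticeNorm Λ w < b := by
      refine hw.trans_lt ?_
      rw [← Real.lt_log_iff_exp_lt hb0]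
      linarith
    have h1 := hΛ.norm_le hθ hh v w
    have hw0 : w ≠ 0 := by
      rintro rfl
      rw [hh.zero_right, norm_zero] at hvw
      exact absurd hvw (by norm_num)
    have haw : a⁻¹ ≤ latticeNorm Λ w := by
      rw [inv_le_iff_one_le_mul₀' ha]
      exact hvw.trans h1
    refine ⟨w, hw0, le_antisymm h1 ?_⟩
    have hwa : latticeNorm Λ w = a⁻¹ := by
      by_contra hne
      have hmem : latticeNorm Λ w ∈ Metric.ball a⁻¹ δ := by
        rw [Metric.mem_ball, Real.dist_eq, abs_of_nonneg (by linarith)]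
        linarith [hwb.trans_le (min_le_left (a⁻¹ + δ) (2 * a⁻¹))]
      exact hball hmem ⟨⟨haw, hwb.le.trans (min_le_right _ _), hGval w hw0⟩, hne⟩
    rw [hwa, mul_inv_cancel₀ ha.ne']
    exact hvw

theorem closedBall_eq (hθ : IsDiscreteNorm D θ) (hh : IsHermitianForm ρ s h)
    (hΛ : IsSelfDualLatticeFunction θ h Λ) (hN : IsUltranorm (latticeNorm Λ)) (t : ℝ) :
    hN.closedBall t = Λ t := by
  ext v
  rw [hΛ.mem_iff hθ hh, IsUltranorm.mem_closedBall]

theorem openBall_eq (hθ : IsDiscreteNorm D θ) (hh : IsHermitianForm ρ s h)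
    (hΛ : IsSelfDualLatticeFunction θ h Λ) (hN : IsUltranorm (latticeNorm Λ)) (t : ℝ) :
    hN.openBall t = ⨆ r > t, Λ r := by
  have hdir : Directed (· ≤ ·) fun r : {r // r > t} => Λ r := fun a b =>
    ⟨⟨min a b, lt_min a.2 b.2⟩, hΛ.antitone _ _ (min_le_left _ _),
      hΛ.antitone _ _ (min_le_right _ _)⟩
  have : Nonempty {r // r > t} := ⟨⟨t + 1, by simp⟩⟩
  ext v
  rw [iSup_subtype', AddSubgroup.mem_iSup_of_directed hdir, IsUltranorm.mem_openBall]
  simp only [hΛ.mem_iff hθ hh]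
  constructor
  · intro hv
    obtain ⟨c, hc1, hc2⟩ := exists_between hv
    have hc0 : 0 < c := (hN.nonneg v).trans_lt hc1
    refine ⟨⟨-Real.log c, ?_⟩, ?_⟩
    · have := Real.log_lt_log hc0 hc2
      rw [Real.log_exp] at this
      exact lt_neg_of_lt_neg this
    · rw [neg_neg, Real.exp_log hc0]
      exact hc1.le
  · rintro ⟨⟨r, hr⟩, hv⟩
    exact hv.trans_lt (Real.exp_lt_exp.2 (neg_lt_neg hr))

theorem jump_eq_card (hθ : IsDiscreteNorm D θ) (hh : IsHermitianForm ρ s h)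
    (hΛ : IsSelfDualLatticeFunction θ h Λ) (hN : IsUltranorm (latticeNorm Λ)) (t : ℝ) :
    hN.jump t = Nat.card (↥(Λ t) ⧸ ((⨆ r > t, Λ r).addSubgroupOf (Λ t))) := by
  rw [IsUltranorm.jump, hΛ.closedBall_eq hθ hh, hΛ.openBall_eq hθ hh]
  rfl

theorem jump_ne_zero [IsUltrametricDist D] (hθ : IsDiscreteNorm D θ)
    (hq : (isUltranorm_norm D).jump 0 ≠ 0) (hh : IsHermitianForm ρ s h)
    (hΛ : IsSelfDualLatticeFunction θ h Λ) (hN : IsVectorNorm (D := D) (latticeNorm Λ)) (t : ℝ) :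
    hN.toIsUltranorm.jump t ≠ 0 := by
  obtain ⟨S, hS, hgen⟩ := hΛ.finitelyGenerated t
  let φ : (S → D) →+ V := AddMonoidHom.mk' (fun a => ∑ u, MulOpposite.op (a u) • (u : V))
    (by simp [add_smul, Finset.sum_add_distrib])
  have hφ : ∀ a, φ a = ∑ u, MulOpposite.op (a u) • (u : V) := fun _ => rfl
  have hS' : ∀ u : S, latticeNorm Λ u ≤ Real.exp (-t) := fun u =>
    (hΛ.mem_iff hθ hh _ _).1 (hS u.2)
  have hclosed : hN.toIsUltranorm.closedBall t
      ≤ (AddSubgroup.pi Set.univ fun _ : S => (isUltranorm_norm D).closedBall 0).map φ := by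
    rw [hΛ.closedBall_eq hθ hh]
    intro v hv
    refine (AddSubgroup.closure_le _).2 ?_ (hgen v hv)
    classical
    rintro w ⟨u, hu, y, hy, rfl⟩
    refine ⟨Pi.single ⟨u, hu⟩ y, fun i _ => ?_, ?_⟩
    · change ‖(Pi.single ⟨u, hu⟩ y : S → D) i‖ ≤ Real.exp (-0)
      rw [neg_zero, Real.exp_zero]
      by_cases hi : i = ⟨u, hu⟩
      · subst hi
        simpa using hy
      · simp [hi]
    · rw [hφ, Finset.sum_eq_single ⟨u, hu⟩ (by simp +contextual) (by simp)]
      simp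
  have hopen : (AddSubgroup.pi Set.univ fun _ : S => (isUltranorm_norm D).openBall 0)
      ≤ (hN.toIsUltranorm.openBall t).comap φ := by
    intro a ha
    rw [AddSubgroup.mem_comap, hφ, IsUltranorm.mem_openBall]
    refine hN.sum_lt (Real.exp_pos _) fun u _ => ?_
    have h1 : ‖a u‖ < Real.exp (-0) := ha u (Set.mem_univ u)
    rw [neg_zero, Real.exp_zero] at h1
    rw [hN.map_smul]
    calc _ ≤ Real.exp (-t) * ‖a u‖ := by gcongr; exact hS' u
      _ < Real.exp (-t) := mul_lt_of_lt_one_right (Real.exp_pos _) h1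
  intro h0
  have h1 := AddSubgroup.relIndex_eq_zero_of_le_right hclosed h0
  rw [← AddSubgroup.relIndex_comap] at h1
  have h2 := AddSubgroup.relIndex_eq_zero_of_le_left hopen h1
  rw [relIndex_pi, Finset.prod_const] at h2
  exact hq (eq_zero_of_pow_eq_zero h2)

theorem exists_bound (hθ : IsDiscreteNorm D θ) (hh : IsHermitianForm ρ s h)
    (hΛ : IsSelfDualLatticeFunction θ h Λ) {N' : V → ℝ} (hN' : IsVectorNorm (D := D) N') :
    ∃ B : ℝ, ∀ v, N' v ≤ B * latticeNorm Λ v := by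
  have hN := hΛ.isVectorNorm hθ hh
  obtain ⟨S, -, hgen⟩ := hΛ.finitelyGenerated 0
  obtain ⟨C, hC⟩ := (S.finite_toSet.image N').bddAbove
  have hC' : ∀ u ∈ S, N' u ≤ max C 0 := fun u hu =>
    (hC (Set.mem_image_of_mem N' hu)).trans (le_max_left _ _)
  have hB : ∀ v ∈ Λ 0, N' v ≤ max C 0 := by
    intro v hv
    refine AddSubgroup.closure_induction (p := fun x _ => N' x ≤ max C 0) ?_ ?_ ?_ ?_ (hgen v hv)
    · rintro x ⟨u, hu, y, hy, rfl⟩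
      rw [hN'.map_smul]
      exact (mul_le_of_le_one_right (hN'.nonneg u) hy).trans (hC' u hu)
    · rw [hN'.map_zero]
      exact le_max_right _ _
    · exact fun x y _ _ hx hy => hN'.add_le hx hy
    · exact fun x _ hx => by rwa [hN'.map_neg]
  refine ⟨max C 0 * θ⁻¹, fun v => ?_⟩
  by_cases hv : v = 0
  · simp [hv, hN.map_zero, hN'.map_zero]
  obtain ⟨m, hm1, hm2⟩ := exists_mem_Ioc_zpow (hN.pos hv) (one_lt_inv_iff₀.2 ⟨hθ.pos, hθ.lt_one⟩)
  obtain ⟨π, hπ⟩ := hθ.exists_uniformizer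
  have hθi : 0 < θ⁻¹ := inv_pos.2 hθ.pos
  have hp : ‖π ^ (m + 1)‖ = (θ⁻¹ ^ (m + 1))⁻¹ := by
    rw [norm_zpow, hπ, inv_zpow, inv_inv]
  have hpos : 0 < θ⁻¹ ^ (m + 1) := zpow_pos hθi _
  have h1 := hB (MulOpposite.op (π ^ (m + 1)) • v) (by
    rw [hΛ.mem_iff hθ hh, hN.map_smul, hp, neg_zero, Real.exp_zero, ← div_eq_mul_inv,
      div_le_one hpos]
    exact hm2)
  rw [hN'.map_smul, hp, ← div_eq_mul_inv, div_le_iff₀ hpos] at h1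
  refine h1.trans ?_
  rw [zpow_add_one₀ hθi.ne', mul_assoc, mul_comm _ θ⁻¹]
  gcongr

end IsSelfDualLatticeFunction

theorem one_lt_jump_norm [IsUltrametricDist D] {R : Finset D} (hR : ∀ y ∈ R, ‖y‖ ≤ 1)
    (hRx : ∀ x : D, ‖x‖ ≤ 1 → ∃ y ∈ R, ‖x - y‖ < 1) : 1 < (isUltranorm_norm D).jump 0 := by
  have h0 : (isUltranorm_norm D).jump 0 ≠ 0 := by
    let φ : R → (isUltranorm_norm D).closedBall 0 ⧸
        ((isUltranorm_norm D).openBall 0).addSubgroupOf ((isUltranorm_norm D).closedBall 0) :=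
      fun y => QuotientAddGroup.mk
        ⟨y, by simpa [IsUltranorm.mem_closedBall] using hR y y.2⟩
    have hφ : Function.Surjective φ := by
      intro x
      obtain ⟨⟨x, hx⟩, rfl⟩ := QuotientAddGroup.mk_surjective x
      obtain ⟨y, hy, hxy⟩ := hRx x (by simpa [IsUltranorm.mem_closedBall] using hx)
      refine ⟨⟨y, hy⟩, QuotientAddGroup.eq.2 ?_⟩
      rw [AddSubgroup.mem_addSubgroupOf, IsUltranorm.mem_openBall]
      simpa [neg_add_eq_sub] using hxy
    have := Finite.of_surjective φ hφ
    exact Nat.card_ne_zero.2 ⟨inferInstance, this⟩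
  have h1 : (isUltranorm_norm D).jump 0 ≠ 1 := by
    rw [IsUltranorm.jump, Ne, AddSubgroup.relIndex_eq_one]
    intro hle
    have : (1 : D) ∈ (isUltranorm_norm D).openBall 0 :=
      hle (by simp [IsUltranorm.mem_closedBall])
    simp [IsUltranorm.mem_openBall] at this
  omega

theorem card_quotient_iff_exists_isometry [IsUltrametricDist D] [CompleteSpace D]
    [Module.Finite Dᵐᵒᵖ V] (hθ : IsDiscreteNorm D θ) {R : Finset D} (hR : ∀ y ∈ R, ‖y‖ ≤ 1)
    (hRx : ∀ x : D, ‖x‖ ≤ 1 → ∃ y ∈ R, ‖x - y‖ < 1) (h2 : ‖(2 : D)‖ = 1)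
    (hρ : IsInvolution ρ) (hh : IsHermitianForm ρ s h)
    (hΛ : IsSelfDualLatticeFunction θ h Λ) (hΛ' : IsSelfDualLatticeFunction θ h Λ') :
    (∀ t : ℝ, Nat.card (↥(Λ t) ⧸ ((⨆ r > t, Λ r).addSubgroupOf (Λ t)))
        = Nat.card (↥(Λ' t) ⧸ ((⨆ r > t, Λ' r).addSubgroupOf (Λ' t)))) ↔
      ∃ g : V ≃ₗ[Dᵐᵒᵖ] V, (∀ v w : V, h (g v) (g w) = h v w) ∧
        ∀ t : ℝ, (⇑g '' (Λ t : Set V)) = (Λ' t : Set V) := by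
  have hN := hΛ.isSelfDualNorm hθ hh
  have hN' := hΛ'.isSelfDualNorm hθ hh
  constructor
  · intro hcard
    have hq := one_lt_jump_norm hR hRx
    obtain ⟨B, hB⟩ := hΛ.exists_bound hθ hh hN'.toIsVectorNorm
    obtain ⟨g, hg, hgN⟩ := exists_isometry_of_jump_eq hθ hq h2 hh hρ hN hN' hB
      (hΛ.jump_ne_zero hθ (by omega) hh hN.toIsVectorNorm) fun t => by
        rw [hΛ.jump_eq_card hθ hh, hΛ'.jump_eq_card hθ hh, hcard]
    refine ⟨g, hg, fun t => Set.ext fun v => ?_⟩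
    rw [← LinearEquiv.coe_toEquiv, Equiv.image_eq_preimage_symm, Set.mem_preimage, SetLike.mem_coe,
      SetLike.mem_coe, hΛ.mem_iff hθ hh, hΛ'.mem_iff hθ hh, ← hgN]
    simp
  · rintro ⟨g, -, hg⟩ t
    have hmap : ∀ t, (Λ t).map g.toAddEquiv.toAddMonoidHom = Λ' t := fun t =>
      SetLike.coe_injective (hg t)
    have hsup : (⨆ r > t, Λ r).map g.toAddEquiv.toAddMonoidHom = ⨆ r > t, Λ' r := by
      simp only [AddSubgroup.map_iSup, hmap]
    have h1 := AddSubgroup.relIndex_map_map_of_injective (⨆ r > t, Λ r) (Λ t)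
      (f := g.toAddEquiv.toAddMonoidHom) g.injective
    rw [hmap, hsup] at h1
    exact h1.symm

end LatticeFunction

end

end SelfDualLattice

namespace IsLocalValuation

variable {K : Type*} [DivisionRing K] {ν : K → EReal} {e q : ℕ}

theorem map_zero (hν : IsLocalValuation K ν e q) : ν 0 = ⊤ :=
  (hν.eq_top_iff 0).2 rfl

theorem coe_toReal (hν : IsLocalValuation K ν e q) {x : K} (hx : x ≠ 0) :
    ((ν x).toReal : EReal) = ν x := by
  obtain ⟨m, hm⟩ := hν.values x hx
  rw [hm, EReal.toReal_coe]

theorem toReal_mul (hν : IsLocalValuation K ν e q) {x y : K} (hx : x ≠ 0) (hy : y ≠ 0) :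
    (ν (x * y)).toReal = (ν x).toReal + (ν y).toReal := by
  rw [hν.map_mul, ← hν.coe_toReal hx, ← hν.coe_toReal hy, ← EReal.coe_add]
  simp only [EReal.toReal_coe]

theorem map_neg (hν : IsLocalValuation K ν e q) (x : K) : ν (-x) = ν x := by
  have h1 := hν.toReal_mul (one_ne_zero (α := K)) one_ne_zero
  rw [mul_one] at h1
  have h2 := hν.toReal_mul (neg_ne_zero.2 (one_ne_zero (α := K))) (neg_ne_zero.2 one_ne_zero)
  rw [neg_one_mul, neg_neg] at h2
  have h3 : (ν (-1)).toReal = 0 := by linarith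
  rw [neg_eq_neg_one_mul, hν.map_mul, ← hν.coe_toReal (neg_ne_zero.2 (one_ne_zero (α := K))), h3,
    EReal.coe_zero, zero_add]

open Classical in
/-- The multiplicative absolute value `exp (-ν)`. -/
def absVal (ν : K → EReal) (x : K) : ℝ :=
  if x = 0 then 0 else Real.exp (-(ν x).toReal)

theorem absVal_zero : absVal ν 0 = 0 := if_pos rfl

theorem absVal_of_ne_zero {x : K} (hx : x ≠ 0) : absVal ν x = Real.exp (-(ν x).toReal) :=
  if_neg hx

theorem absVal_nonneg (x : K) : 0 ≤ absVal ν x := by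
  rw [absVal]
  split_ifs
  · exact le_rfl
  · exact (Real.exp_pos _).le

theorem absVal_le_exp_iff (hν : IsLocalValuation K ν e q) (x : K) (M : ℝ) :
    absVal ν x ≤ Real.exp (-M) ↔ (M : EReal) ≤ ν x := by
  by_cases hx : x = 0
  · subst hx
    simp [absVal_zero, hν.map_zero, (Real.exp_pos _).le]
  · rw [absVal_of_ne_zero hx, ← hν.coe_toReal hx, EReal.toReal_coe, EReal.coe_le_coe_iff,
      Real.exp_le_exp, neg_le_neg_iff]

theorem absVal_lt_exp_iff (hν : IsLocalValuation K ν e q) (x : K) (M : ℝ) :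
    absVal ν x < Real.exp (-M) ↔ (M : EReal) < ν x := by
  by_cases hx : x = 0
  · subst hx
    simp [absVal_zero, hν.map_zero, Real.exp_pos]
  · rw [absVal_of_ne_zero hx, ← hν.coe_toReal hx, EReal.toReal_coe, EReal.coe_lt_coe_iff,
      Real.exp_lt_exp, neg_lt_neg_iff]

theorem absVal_le_one_iff (hν : IsLocalValuation K ν e q) (x : K) : absVal ν x ≤ 1 ↔ 0 ≤ ν x := by
  simpa using hν.absVal_le_exp_iff x 0

theorem absVal_lt_one_iff (hν : IsLocalValuation K ν e q) (x : K) : absVal ν x < 1 ↔ 0 < ν x := by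
  simpa using hν.absVal_lt_exp_iff x 0

theorem absVal_eq_exp_iff (hν : IsLocalValuation K ν e q) (x : K) (M : ℝ) :
    absVal ν x = Real.exp (-M) ↔ ν x = (M : EReal) := by
  rw [le_antisymm_iff, le_antisymm_iff, hν.absVal_le_exp_iff, and_comm, ← not_lt, ← not_lt,
    hν.absVal_lt_exp_iff, not_lt, not_lt]

theorem absVal_mul (hν : IsLocalValuation K ν e q) (x y : K) :
    absVal ν (x * y) = absVal ν x * absVal ν y := by
  by_cases hx : x = 0
  · simp [hx, absVal_zero]
  by_cases hy : y = 0
  · simp [hy, absVal_zero]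
  rw [absVal_of_ne_zero hx, absVal_of_ne_zero hy, absVal_of_ne_zero (mul_ne_zero hx hy),
    hν.toReal_mul hx hy, ← Real.exp_add, neg_add]

theorem absVal_neg (hν : IsLocalValuation K ν e q) (x : K) : absVal ν (-x) = absVal ν x := by
  by_cases hx : x = 0
  · rw [hx, neg_zero]
  · rw [absVal_of_ne_zero hx, absVal_of_ne_zero (neg_ne_zero.2 hx), hν.map_neg]

theorem absVal_eq_zero {x : K} (hx : absVal ν x = 0) : x = 0 := by
  by_contra h
  rw [absVal_of_ne_zero h] at hx
  exact (Real.exp_pos _).ne' hx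

theorem absVal_add_le (hν : IsLocalValuation K ν e q) (x y : K) :
    absVal ν (x + y) ≤ max (absVal ν x) (absVal ν y) := by
  by_cases h0 : max (absVal ν x) (absVal ν y) = 0
  · have hx := absVal_eq_zero (le_antisymm ((le_max_left _ _).trans h0.le) (absVal_nonneg x))
    have hy := absVal_eq_zero (le_antisymm ((le_max_right _ _).trans h0.le) (absVal_nonneg y))
    simp [hx, hy, absVal_zero]
  have hpos : 0 < max (absVal ν x) (absVal ν y) :=
    ((absVal_nonneg x).trans (le_max_left _ _)).lt_of_ne' h0
  obtain ⟨M, hM⟩ : ∃ M, max (absVal ν x) (absVal ν y) = Real.exp (-M) :=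
    ⟨-Real.log (max (absVal ν x) (absVal ν y)), by rw [neg_neg, Real.exp_log hpos]⟩
  have hx := (le_max_left (absVal ν x) (absVal ν y)).trans_eq hM
  have hy := (le_max_right (absVal ν x) (absVal ν y)).trans_eq hM
  rw [hν.absVal_le_exp_iff] at hx hy
  rw [hM, hν.absVal_le_exp_iff]
  exact (le_min hx hy).trans (hν.min_le_add x y)

/-- The normed division ring structure defined by a valuation. -/
abbrev normedDivisionRing (hν : IsLocalValuation K ν e q) : NormedDivisionRing K :=
  { (inferInstance : DivisionRing K),
    AddGroupNorm.toNormedAddCommGroup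
      { toFun := absVal ν
        map_zero' := absVal_zero
        add_le' := fun x y => (hν.absVal_add_le x y).trans
          (max_le_add_of_nonneg (absVal_nonneg x) (absVal_nonneg y))
        neg' := hν.absVal_neg
        eq_zero_of_map_eq_zero' := fun _ => absVal_eq_zero } with
    norm_mul := hν.absVal_mul }

theorem isUltrametricDist (hν : IsLocalValuation K ν e q) :
    @IsUltrametricDist K hν.normedDivisionRing.toMetricSpace.toDist :=
  letI := hν.normedDivisionRing
  IsUltrametricDist.isUltrametricDist_of_forall_norm_add_le_max_norm hν.absVal_add_le

theorem completeSpace (hν : IsLocalValuation K ν e q) :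
    @CompleteSpace K hν.normedDivisionRing.toMetricSpace.toUniformSpace := by
  let _ := hν.normedDivisionRing
  refine Metric.complete_of_cauchySeq_tendsto fun u hu => ?_
  obtain ⟨l, hl⟩ := hν.complete u fun M => by
    obtain ⟨N, hN⟩ := Metric.cauchySeq_iff.1 hu _ (Real.exp_pos (-M))
    refine ⟨N, fun m hm n hn => (hν.absVal_le_exp_iff _ _).1 ?_⟩
    exact (dist_eq_norm (u m) (u n)).symm.trans_le (hN m hm n hn).le
  refine ⟨l, Metric.tendsto_atTop.2 fun δ hδ => ?_⟩
  obtain ⟨N, hN⟩ := hl (-Real.log (δ / 2))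
  refine ⟨N, fun n hn => ?_⟩
  have h1 : ‖u n - l‖ ≤ _ := (hν.absVal_le_exp_iff _ _).2 (hN n hn)
  rw [neg_neg, Real.exp_log (half_pos hδ)] at h1
  rw [dist_eq_norm]
  linarith

theorem isDiscreteNorm (hν : IsLocalValuation K ν e q) :
    @SelfDualLattice.IsDiscreteNorm K hν.normedDivisionRing (Real.exp (-(e : ℝ)⁻¹)) := by
  let _ := hν.normedDivisionRing
  have he : (0 : ℝ) < (e : ℝ)⁻¹ := inv_pos.2 (Nat.cast_pos.2 hν.e_pos)
  refine ⟨Real.exp_pos _, Real.exp_lt_one_iff.2 (neg_lt_zero.2 he), fun x hx => ?_, ?_⟩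
  · obtain ⟨m, hm⟩ := hν.values x hx
    refine ⟨m, ((hν.absVal_eq_exp_iff _ _).2 hm).trans ?_⟩
    rw [← Real.rpow_intCast, ← Real.exp_mul]
    congr 1
    ring
  · obtain ⟨π, hπ⟩ := hν.exists_uniformizer
    exact ⟨π, (hν.absVal_eq_exp_iff _ _).2 hπ⟩

end IsLocalValuation

theorem IsLatticeFunction.isSelfDualLatticeFunction {D V : Type*} [DivisionRing D]
    [AddCommGroup V] [Module Dᵐᵒᵖ V] {ν : D → EReal} {e q : ℕ} (hν : IsLocalValuation D ν e q)
    {h : V → V → D} {Λ : ℝ → AddSubgroup V} (hΛ : IsLatticeFunction ν e Λ)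
    (hsd : ∀ (t : ℝ) (v : V), v ∈ Λ t ↔
      ∀ w : V, (∃ r : ℝ, -t < r ∧ w ∈ Λ r) → 0 < ν (h v w)) :
    letI := hν.normedDivisionRing
    SelfDualLattice.IsSelfDualLatticeFunction (Real.exp (-(e : ℝ)⁻¹)) h Λ := by
  let _ := hν.normedDivisionRing
  have hle : ∀ y : D, ‖y‖ ≤ 1 ↔ 0 ≤ ν y := hν.absVal_le_one_iff
  have hlt : ∀ y : D, ‖y‖ < 1 ↔ 0 < ν y := hν.absVal_lt_one_iff
  obtain ⟨hlat, hanti, hleft, hper⟩ := hΛ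
  refine ⟨fun t v hv y hy => (hlat t).1 v hv y ((hle y).1 hy), fun t => ?_, fun t => (hlat t).2.2,
    hanti, hleft, fun π hπ t w => ?_, fun t v => ?_⟩
  · simp only [hle]
    exact (hlat t).2.1
  · rw [Real.log_exp, sub_neg_eq_add]
    exact hper π ((hν.absVal_eq_exp_iff _ _).1 hπ) t w
  · simp only [hlt]
    exact hsd t v

theorem isHermitianForm_of_sesquilinear {D V : Type*} [NormedDivisionRing D] [AddCommGroup V]
    [Module Dᵐᵒᵖ V] {ρ : D → D} (hρ : SelfDualLattice.IsInvolution ρ) {s : D}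
    (hs : s = 1 ∨ s = -1) {h : V → V → D}
    (haddl : ∀ v v' w, h (v + v') w = h v w + h v' w)
    (haddr : ∀ v w w', h v (w + w') = h v w + h v w')
    (hherm : ∀ (a b : D) (v w : V),
      h (MulOpposite.op a • v) (MulOpposite.op b • w) = ρ a * (s * ρ (h w v)) * b)
    (hnd : ∀ v, (∀ w, h v w = 0) → v = 0) :
    SelfDualLattice.IsHermitianForm ρ s h := by
  have hρ1 := hρ.map_one
  have hswap : ∀ v w, h v w = s * ρ (h w v) := fun v w => by
    simpa [hρ1] using hherm 1 1 v w
  refine ⟨hs, haddl, haddr, fun a v w => ?_, fun a v w => ?_, hswap, hnd⟩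
  · simpa [← hswap v w] using hherm a 1 v w
  · simpa [← hswap v w, hρ1] using hherm 1 a v w

/-- `k` a non-Archimedean local field of odd residue characteristic,
`D` a central division `k`-algebra of index `d ∈ {1,2}` with involution `ρ`, `V` a
finite-dimensional right `D`-vector space with non-degenerate `ε`-Hermitian form `h`,
and `Λ`, `Λ′` self-dual `o_D`-lattice functions of `V` with respect to `h`.  The
following are equivalent:
1. for every `t ∈ ℝ`, the (finite) `κ_D`-vector spaces `Λ(t)/Λ(t+)` and `Λ′(t)/Λ′(t+)`
   have the same dimension (equivalently, since `κ_D` is finite, the same cardinality);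
2. there is `g ∈ U(h)` with `g(Λ(t)) = Λ′(t)` for all `t ∈ ℝ`. -/
theorem stmt_13
    {k D V : Type*} [Field k] [DivisionRing D] [Algebra k D]
    [AddCommGroup V] [Module Dᵐᵒᵖ V] [Module k V]
    [IsScalarTower k Dᵐᵒᵖ V] [SMulCommClass Dᵐᵒᵖ k V] [Module.Finite Dᵐᵒᵖ V]
    (νk : k → EReal) (νD : D → EReal) (q qD d : ℕ)
    (hk : IsLocalValuation k νk 1 q) (hD : IsLocalValuation D νD d qD)
    (hcompatD : ∀ c : k, νD (algebraMap k D c) = νk c)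
    (hoddres : νk 2 = 0)
    (hd : d = 1 ∨ d = 2) (hdim : Module.finrank k D = d * d)
    (hcentral : ∀ z : D, (∀ w, z * w = w * z) → ∃ c : k, algebraMap k D c = z)
    (ρ : D → D) (ρ₀ : k → k)
    (hρadd : ∀ x y, ρ (x + y) = ρ x + ρ y)
    (hρmul : ∀ x y, ρ (x * y) = ρ y * ρ x)
    (hρinv : ∀ x, ρ (ρ x) = x)
    (hρk : ∀ c : k, ρ (algebraMap k D c) = algebraMap k D (ρ₀ c))
    (ε : k) (hε : ε = 1 ∨ ε = -1)
    (h : V → V → D)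
    (haddl : ∀ v v' w, h (v + v') w = h v w + h v' w)
    (haddr : ∀ v w w', h v (w + w') = h v w + h v w')
    (hherm : ∀ (a b : D) (v w : V),
      h (MulOpposite.op a • v) (MulOpposite.op b • w) = ρ a * (ε • ρ (h w v)) * b)
    (hnd : ∀ v, (∀ w, h v w = 0) → v = 0)
    -- `Λ` and `Λ′` are self-dual `o_D`-lattice functions with respect to `h`
    (Λ Λ' : ℝ → AddSubgroup V)
    (hΛ : IsLatticeFunction νD d Λ) (hΛ' : IsLatticeFunction νD d Λ')
    (hΛsd : ∀ (t : ℝ) (v : V), v ∈ Λ t ↔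
      ∀ w : V, (∃ r : ℝ, -t < r ∧ w ∈ Λ r) → 0 < νD (h v w))
    (hΛ'sd : ∀ (t : ℝ) (v : V), v ∈ Λ' t ↔
      ∀ w : V, (∃ r : ℝ, -t < r ∧ w ∈ Λ' r) → 0 < νD (h v w)) :
    (∀ t : ℝ,
        Nat.card (↥(Λ t) ⧸ ((⨆ r > t, Λ r).addSubgroupOf (Λ t)))
          = Nat.card (↥(Λ' t) ⧸ ((⨆ r > t, Λ' r).addSubgroupOf (Λ' t)))) ↔
    (∃ g : V ≃ₗ[Dᵐᵒᵖ] V, (∀ v w : V, h (g v) (g w) = h v w) ∧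
        ∀ t : ℝ, (⇑g '' (Λ t : Set V)) = (Λ' t : Set V)) := by
  let _ := hD.normedDivisionRing
  have := hD.isUltrametricDist
  have := hD.completeSpace
  obtain ⟨R, -, hR, hRx⟩ := hD.residue
  have h2 : ‖(2 : D)‖ = Real.exp (-0) := (hD.absVal_eq_exp_iff _ _).2 (by
    rw [EReal.coe_zero, ← hoddres, ← hcompatD, map_ofNat])
  have hρ : SelfDualLattice.IsInvolution ρ := ⟨hρadd, hρmul, hρinv⟩
  have hs : algebraMap k D ε = 1 ∨ algebraMap k D ε = -1 := by
    rcases hε with rfl | rfl <;> simp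
  refine SelfDualLattice.card_quotient_iff_exists_isometry hD.isDiscreteNorm
    (fun y hy => (hD.absVal_le_one_iff y).2 (hR y hy)) (fun x hx => ?_) (by simpa using h2) hρ
    (isHermitianForm_of_sesquilinear hρ hs haddl haddr
      (by simpa only [Algebra.smul_def] using hherm) hnd)
    (hΛ.isSelfDualLatticeFunction hD hΛsd) (hΛ'.isSelfDualLatticeFunction hD hΛ'sd)
  obtain ⟨y, ⟨hy, hxy⟩, -⟩ := hRx x ((hD.absVal_le_one_iff x).1 hx)
  exact ⟨y, hy, (hD.absVal_lt_one_iff _).2 hxy⟩
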